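/- Let G be a connected simple graph with m edges, m ≥ 3, such that every vertex of degree at least three is a support vertex. Then G is arithmetic antimagic, i.e., for every strictly increasing arithmetic sequence L of m positive real numbers there exists an antimagic L-labeling of G. -/

import Mathlib

open scoped Classical

noncomputable def edgeFS {V : Type*} [Fintype V] (G : SimpleGraph V) : Finset (Sym2 V) :=
  G.edgeSet.toFinset

noncomputable def vSum {V : Type*} [Fintype V] (G : SimpleGraph V) (φ : Sym2 V → ℝ) (v : V) : ℝ :=
  ∑ e ∈ (edgeFS G).filter (fun e => v ∈ e), φ e

noncomputable def vProd {V : Type*} [Fintype V] (G : SimpleGraph V) (φ : Sym2 V → ℝ) (v : V) : ℝ :=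
  ∏ e ∈ (edgeFS G).filter (fun e => v ∈ e), φ e

/-- `G` admits an antimagic `L`-labeling for every strictly increasing arithmetic
sequence `L` of positive reals of length `(edgeFS G).card`. -/
def ArithAntimagic {V : Type*} [Fintype V] (G : SimpleGraph V) : Prop :=
  ∀ a d : ℝ, 0 < a → 0 < d →
    ∃ φ : Sym2 V → ℝ,
      Set.BijOn φ ↑(edgeFS G)
        ↑((Finset.range (edgeFS G).card).image (fun i : ℕ => a + (i : ℝ) * d)) ∧
      Function.Injective (vSum G φ)

theorem exists_eq_of_causal {ι : Type*} (pos : ι → ℕ) (F : ι → (ι → ℕ) → ℕ)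
    (hF : ∀ i g g', (∀ j, pos j < pos i → g j = g' j) → F i g = F i g') :
    ∃ g : ι → ℕ, ∀ i, g i = F i g := by
  let g : ι → ℕ := (measure pos).wf.fix
    (fun i ih => F i (fun j => if h : pos j < pos i then ih j h else 0))
  refine ⟨g, fun i => ?_⟩
  have h : g i = F i (fun j => if pos j < pos i then g j else 0) := by
    change (measure pos).wf.fix _ i = _
    rw [WellFounded.fix_eq]
    congr 1
  rw [h]
  exact hF _ _ _ fun j hj => by simp [hj]

/-- The number of elements of `S` preceding `e`. -/
noncomputable def before {ε : Type*} (pos : ε → ℕ) (S : Finset ε) (e : ε) : ℕ :=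
  (S.filter fun e' => pos e' < pos e).card

theorem before_lt_card {ε : Type*} {pos : ε → ℕ} {S : Finset ε} {e : ε} (he : e ∈ S) :
    before pos S e < S.card := by
  apply Finset.card_lt_card
  rw [Finset.filter_ssubset]
  exact ⟨e, he, lt_irrefl _⟩

theorem before_mono {ε : Type*} {pos : ε → ℕ} {S : Finset ε} {e e' : ε} (h : pos e ≤ pos e') :
    before pos S e ≤ before pos S e' := by
  apply Finset.card_le_card
  intro x
  simp only [Finset.mem_filter]
  exact fun hx => ⟨hx.1, hx.2.trans_le h⟩

theorem before_lt_before {ε : Type*} {pos : ε → ℕ} {S : Finset ε} {e e' : ε} (he : e ∈ S)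
    (h : pos e < pos e') : before pos S e < before pos S e' := by
  apply Finset.card_lt_card
  rw [Finset.ssubset_iff_of_subset]
  · exact ⟨e, by simp [he, h]⟩
  · intro x
    simp only [Finset.mem_filter]
    exact fun hx => ⟨hx.1, hx.2.trans h⟩

/-- The smallest labels are distributed between the edges of `X`, in the order of their positions,
and one further edge for each vertex of `H`: the edge of `v` comes after `e ∈ X` exactly when the
sum of the other labels around `v` exceeds `t e`. -/
theorem exists_small_labels {ε V : Type*} (X : Finset ε) (H : Finset V) (pos : ε → ℕ)
    (t : ε → ℝ) (inc : V → ε → Prop) (base : V → ℝ) (α : ℝ) (hα : 0 ≤ α) [Finite V]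
    (ht : ∀ e e', pos e ≤ pos e' → t e ≤ t e')
    (hown : ∀ v ∈ H, ∀ e ∈ X, inc v e → t e < base v + (α + before pos X e)) :
    ∃ (g : ε → ℕ) (q : V → ℕ) (P : V → ℝ),
      (∀ v, P v = base v + ∑ e ∈ X.filter (inc v), (α + g e)) ∧
      (∀ e ∈ X, g e < X.card + H.card) ∧ (∀ v ∈ H, q v < X.card + H.card) ∧
      (∀ e ∈ X, ∀ e' ∈ X, pos e < pos e' → g e < g e') ∧
      (∀ v ∈ H, ∀ e ∈ X, P v ≤ t e → q v < g e) ∧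
      (∀ v ∈ H, ∀ e ∈ X, t e < P v → g e < q v) ∧
      (∀ v ∈ H, ∀ w ∈ H, v ≠ w → (P v ≤ P w ∧ q v < q w) ∨ (P w ≤ P v ∧ q w < q v)) := by
  obtain ⟨n, ⟨o⟩⟩ := Finite.exists_equiv_fin V
  obtain ⟨g, hg⟩ := exists_eq_of_causal pos (fun e g => before pos X e +
    (H.filter fun v => (∀ e' ∈ X, inc v e' → pos e' < pos e) ∧
      base v + ∑ e' ∈ X.filter (fun e' => inc v e' ∧ pos e' < pos e), (α + g e') ≤ t e).card) (by
    intro e g g' h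
    congr 3
    ext v
    rw [Finset.sum_congr rfl (g := fun e' => α + (g' e' : ℝ))]
    intro x hx
    rw [h x (Finset.mem_filter.1 hx).2.2])
  set P : V → ℝ := fun v => base v + ∑ e ∈ X.filter (inc v), (α + g e) with hP
  have hg0 : ∀ e, before pos X e ≤ g e := fun e => by rw [hg]; omega
  have hPown : ∀ v ∈ H, ∀ e ∈ X, inc v e → t e < P v := by
    intro v hv e he hi
    have h1 := hown v hv e he hi
    have h2 : (α + g e : ℝ) ≤ ∑ e ∈ X.filter (inc v), (α + g e) :=
      Finset.single_le_sum (f := fun e => (α + g e : ℝ)) (fun i _ => by positivity)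
        (Finset.mem_filter.2 ⟨he, hi⟩)
    have h3 : (before pos X e : ℝ) ≤ g e := by exact_mod_cast hg0 e
    simp only [hP]
    linarith
  have hg' : ∀ e ∈ X, g e = before pos X e + (H.filter fun v => P v ≤ t e).card := by
    intro e he
    rw [hg]
    congr 2
    ext v
    simp only [Finset.mem_filter, and_congr_right_iff]
    intro hv
    have key : (∀ e' ∈ X, inc v e' → pos e' < pos e) →
        X.filter (fun e' => inc v e' ∧ pos e' < pos e) = X.filter (inc v) := by
      intro h
      ext e'
      simp only [Finset.mem_filter]
      exact ⟨fun h' => ⟨h'.1, h'.2.1⟩, fun h' => ⟨h'.1, h'.2, h e' h'.1 h'.2⟩⟩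
    constructor
    · rintro ⟨h1, h2⟩
      rwa [key h1] at h2
    · intro h
      have h1 : ∀ e' ∈ X, inc v e' → pos e' < pos e := by
        intro e' he' hi
        by_contra hlt
        have := ht e e' (not_lt.1 hlt)
        have := hPown v hv e' he' hi
        linarith
      exact ⟨h1, by rw [key h1]; exact h⟩
  let K : V → ℝ ×ₗ Fin n := fun v => toLex (P v, o v)
  have hK : ∀ v w, K v < K w → P v ≤ P w := by
    intro v w h
    rcases Prod.Lex.toLex_lt_toLex.1 h with h | h
    · exact h.le
    · exact h.1.le
  let q : V → ℕ := fun v => (X.filter fun e => t e < P v).card + (H.filter fun w => K w < K v).card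
  have hq : ∀ v ∈ H, ∀ w, K v < K w → q v < q w := by
    intro v hv w h
    apply add_lt_add_of_le_of_lt
    · apply Finset.card_le_card
      intro e
      simp only [Finset.mem_filter]
      exact fun he => ⟨he.1, he.2.trans_le (hK v w h)⟩
    · apply Finset.card_lt_card
      rw [Finset.ssubset_iff_of_subset]
      · exact ⟨v, by simp [hv, h]⟩
      · intro x
        simp only [Finset.mem_filter]
        exact fun hx => ⟨hx.1, hx.2.trans h⟩
  refine ⟨g, q, P, fun v => rfl, ?_, ?_, ?_, ?_, ?_, ?_⟩
  · intro e he
    rw [hg' e he]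
    exact add_lt_add_of_lt_of_le (before_lt_card he) (Finset.card_filter_le _ _)
  · intro v hv
    refine add_lt_add_of_le_of_lt (Finset.card_filter_le _ _) (Finset.card_lt_card ?_)
    rw [Finset.filter_ssubset]
    exact ⟨v, hv, lt_irrefl _⟩
  · intro e he e' he' h
    rw [hg' e he, hg' e' he']
    apply add_lt_add_of_lt_of_le (before_lt_before he h)
    apply Finset.card_le_card
    intro v
    simp only [Finset.mem_filter]
    exact fun hv => ⟨hv.1, hv.2.trans (ht e e' h.le)⟩
  · intro v hv e he h
    rw [hg' e he]
    apply add_lt_add_of_le_of_lt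
    · apply Finset.card_le_card
      intro e'
      simp only [Finset.mem_filter]
      refine fun he' => ⟨he'.1, ?_⟩
      by_contra hlt
      have := ht e e' (not_lt.1 hlt)
      linarith [he'.2]
    · apply Finset.card_lt_card
      rw [Finset.ssubset_iff_of_subset]
      · exact ⟨v, by simp [hv, h]⟩
      · intro x
        simp only [Finset.mem_filter]
        exact fun hx => ⟨hx.1, (hK x v hx.2).trans h⟩
  · intro v hv e he h
    rw [hg' e he]
    apply add_lt_add_of_lt_of_le
    · apply Finset.card_lt_card
      rw [Finset.ssubset_iff_of_subset]
      · exact ⟨e, by simp [he, h]⟩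
      · intro x
        simp only [Finset.mem_filter]
        exact fun hx => ⟨hx.1, (ht x e hx.2.le).trans_lt h⟩
    · apply Finset.card_le_card
      intro w
      simp only [Finset.mem_filter]
      exact fun hw => ⟨hw.1, Prod.Lex.toLex_lt_toLex.2 (Or.inl (hw.2.trans_lt h))⟩
  · intro v hv w hw hne
    rcases lt_trichotomy (K v) (K w) with h | h | h
    · exact Or.inl ⟨hK _ _ h, hq v hv w h⟩
    · exact absurd (o.injective (Prod.ext_iff.1 (toLex.injective h)).2) hne
    · exact Or.inr ⟨hK _ _ h, hq w hw v h⟩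

theorem before_le_of_pos_eq_succ {ε : Type*} {pos : ε → ℕ} {X Y : Finset ε} (hXY : Disjoint X Y)
    (hpos : Set.InjOn pos {e | e ∈ X ∨ e ∈ Y}) {x y : ε} (hx : x ∈ X) (h : pos y ≤ pos x + 1) :
    before pos Y y ≤ before pos Y x := by
  apply Finset.card_le_card
  intro e
  simp only [Finset.mem_filter]
  rintro ⟨he, hlt⟩
  refine ⟨he, lt_of_le_of_ne (by omega) fun heq => ?_⟩
  have := hpos (by simp [he]) (by simp [hx]) heq
  exact Finset.disjoint_left.1 hXY hx (this ▸ he)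

theorem before_le_succ_of_pos_le {ε : Type*} {pos : ε → ℕ} {Y : Finset ε}
    (hpos : Set.InjOn pos ↑Y) {x y : ε} (hy : y ∈ Y) (h : pos x ≤ pos y + 1) :
    before pos Y x ≤ before pos Y y + 1 := by
  have : Y.filter (fun e => pos e < pos x) ⊆ insert y (Y.filter fun e => pos e < pos y) := by
    intro e
    simp only [Finset.mem_filter, Finset.mem_insert]
    rintro ⟨he, hlt⟩
    by_cases hey : e = y
    · exact Or.inl hey
    · exact Or.inr ⟨he, lt_of_le_of_ne (by omega) fun heq => hey (hpos he hy heq)⟩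
  exact (Finset.card_le_card this).trans (Finset.card_insert_le _ _)

/-- Labels with pairwise distinct vertex sums, for an edge set split into small edges `X`, big edges
`Y` and one reserved edge for each vertex of `H`, the first two kinds being listed by `pos`. -/
theorem exists_injective_sum {ε V : Type*} [Finite V] (X Y E : Finset ε) (H : Finset V)
    (res : V → ε) (inc : V → ε → Prop) (pos : ε → ℕ) (α : ℝ) (hα : 0 < α)
    (hE : ∀ e, e ∈ E ↔ e ∈ X ∨ e ∈ Y ∨ ∃ v ∈ H, res v = e)
    (hXY : Disjoint X Y) (hpos : Set.InjOn pos {e | e ∈ X ∨ e ∈ Y})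
    (hresX : ∀ v ∈ H, res v ∉ X) (hresY : ∀ v ∈ H, res v ∉ Y)
    (hres : ∀ v ∈ H, ∀ w ∈ H, inc w (res v) ↔ w = v)
    (hbig : ∀ v ∈ H, ∃ y ∈ Y, inc v y)
    (hprefix : ∀ v ∈ H, ∀ e ∈ X, inc v e → before pos Y e ≤ before pos X e + 1)
    (hrest : ∀ w, w ∉ H →
      (∃ x ∈ X, ∃ y ∈ Y, (pos y ≤ pos x + 1 ∧ pos x ≤ pos y + 1) ∧
        E.filter (inc w) = {x, y}) ∨
      ∃ e ∈ E, (e ∈ Y → before pos Y e = 0) ∧ E.filter (inc w) = {e})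
    (hinj : Function.Injective fun v => E.filter (inc v)) :
    ∃ idx : ε → ℕ, Set.BijOn idx E (Finset.range E.card) ∧
      Function.Injective fun v => ∑ e ∈ E.filter (inc v), (α + idx e) := by
  set s : ℕ := X.card + H.card with hs
  have hposX : Set.InjOn pos ↑X := hpos.mono fun _ => Or.inl
  have hposY : Set.InjOn pos ↑Y := hpos.mono fun _ => Or.inr
  obtain ⟨g, q, P, hP, hgs, hqs, hgg, hqg, hgq, hqq⟩ := exists_small_labels X H pos
    (fun e => α + s + before pos Y e - 1) inc
    (fun v => ∑ y ∈ Y.filter (inc v), (α + s + before pos Y y)) α hα.le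
    (by
      intro e e' h
      have : (before pos Y e : ℝ) ≤ before pos Y e' := by exact_mod_cast before_mono h
      simpa using this)
    (by
      intro v hv e he hi
      obtain ⟨y, hy, hiy⟩ := hbig v hv
      have h1 : (α + s + before pos Y y : ℝ) ≤ ∑ y ∈ Y.filter (inc v), (α + s + before pos Y y) :=
        Finset.single_le_sum (f := fun y => (α + s + before pos Y y : ℝ))
          (fun i _ => by positivity) (Finset.mem_filter.2 ⟨hy, hiy⟩)
      have h2 : (before pos Y e : ℝ) ≤ before pos X e + 1 := by
        exact_mod_cast hprefix v hv e he hi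
      have h3 : (0 : ℝ) ≤ before pos Y y := by positivity
      linarith)
  have hXnot : ∀ {e}, e ∈ X → e ∉ Y := fun h => Finset.disjoint_left.1 hXY h
  have hresinj : Set.InjOn res ↑H := fun v hv w hw h =>
    (hres w hw v hv).1 (h ▸ (hres v hv v hv).2 rfl)
  let idx : ε → ℕ := fun e => if e ∈ Y then s + before pos Y e else if e ∈ X then g e else
    if h : ∃ v ∈ H, res v = e then q h.choose else 0
  have idxY : ∀ e ∈ Y, idx e = s + before pos Y e := fun e he => by simp [idx, he]
  have idxX : ∀ e ∈ X, idx e = g e := fun e he => by simp [idx, he, hXnot he]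
  have idxR : ∀ v ∈ H, idx (res v) = q v := by
    intro v hv
    have h : ∃ w ∈ H, res w = res v := ⟨v, hv, rfl⟩
    have h' : h.choose = v := hresinj h.choose_spec.1 hv h.choose_spec.2
    simp only [idx, hresX v hv, hresY v hv, if_false, dif_pos h, h']
  have gq : ∀ e ∈ X, ∀ v ∈ H, g e ≠ q v := by
    intro e he v hv h
    rcases le_or_gt (P v) (α + s + before pos Y e - 1) with h' | h'
    · have := hqg v hv e he h'; omega
    · have := hgq v hv e he h'; omega
  have gne : ∀ e ∈ X, ∀ e' ∈ X, g e = g e' → e = e' := by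
    intro e he e' he' h
    by_contra hne
    rcases lt_trichotomy (pos e) (pos e') with h' | h' | h'
    · have := hgg e he e' he' h'; omega
    · exact hne (hposX he he' h')
    · have := hgg e' he' e he h'; omega
  have bne : ∀ e ∈ Y, ∀ e' ∈ Y, before pos Y e = before pos Y e' → e = e' := by
    intro e he e' he' h
    by_contra hne
    rcases lt_trichotomy (pos e) (pos e') with h' | h' | h'
    · have := before_lt_before he h'; omega
    · exact hne (hposY he he' h')
    · have := before_lt_before he' h'; omega
  have hinjOn : Set.InjOn idx E := by
    intro e he e' he' h
    rw [Finset.mem_coe, hE] at he he'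
    rcases he with he | he | ⟨v, hv, rfl⟩ <;> rcases he' with he' | he' | ⟨v', hv', rfl⟩
    · rw [idxX _ he, idxX _ he'] at h
      exact gne _ he _ he' h
    · rw [idxX _ he, idxY _ he'] at h
      have := hgs e he; omega
    · rw [idxX _ he, idxR _ hv'] at h
      exact absurd h (gq _ he _ hv')
    · rw [idxY _ he, idxX _ he'] at h
      have := hgs e' he'; omega
    · rw [idxY _ he, idxY _ he'] at h
      exact bne _ he _ he' (by omega)
    · rw [idxY _ he, idxR _ hv'] at h
      have := hqs _ hv'; omega
    · rw [idxR _ hv, idxX _ he'] at h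
      exact absurd h.symm (gq _ he' _ hv)
    · rw [idxR _ hv, idxY _ he'] at h
      have := hqs _ hv; omega
    · rw [idxR _ hv, idxR _ hv'] at h
      by_contra hne
      rcases hqq v hv v' hv' (fun h => hne (by rw [h])) with h' | h' <;> omega
  have hEeq : E = (X ∪ Y) ∪ H.image res := by
    ext e; simp [hE]
  have hdis : Disjoint (X ∪ Y) (H.image res) := by
    rw [Finset.disjoint_right]
    intro e
    simp only [Finset.mem_image, Finset.mem_union]
    rintro ⟨v, hv, rfl⟩
    simp [hresX v hv, hresY v hv]
  have hcard : E.card = s + Y.card := by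
    rw [hEeq, Finset.card_union_of_disjoint hdis, Finset.card_union_of_disjoint hXY,
      Finset.card_image_of_injOn hresinj]
    omega
  have hmaps : Set.MapsTo idx E (Finset.range E.card) := by
    intro e he
    rw [Finset.mem_coe, hE] at he
    simp only [Finset.coe_range, Set.mem_Iio, hcard]
    rcases he with he | he | ⟨v, hv, rfl⟩
    · have := hgs e he; rw [idxX e he]; omega
    · have := before_lt_card (pos := pos) he; rw [idxY e he]; omega
    · have := hqs v hv; rw [idxR v hv]; omega
  refine ⟨idx, ⟨hmaps, hinjOn, Finset.surjOn_of_injOn_of_card_le _ hmaps hinjOn (by simp)⟩, ?_⟩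
  have sumD : ∀ w x y, x ∈ X → y ∈ Y → E.filter (inc w) = {x, y} →
      ∑ e ∈ E.filter (inc w), (α + idx e) = (α + g x) + (α + s + before pos Y y) := by
    intro w x y hx hy h
    rw [h, Finset.sum_pair (fun h : x = y => hXnot hx (h ▸ hy)), idxX x hx, idxY y hy]
    push_cast; ring
  have sumH : ∀ v ∈ H, ∑ e ∈ E.filter (inc v), (α + idx e) = P v + (α + q v) := by
    intro v hv
    have h : E.filter (inc v) = (Y.filter (inc v) ∪ X.filter (inc v)) ∪ {res v} := by
      ext e
      simp only [Finset.mem_filter, hE, Finset.mem_union, Finset.mem_singleton]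
      constructor
      · rintro ⟨h | h | ⟨w, hw, rfl⟩, hi⟩
        · exact Or.inl (Or.inr ⟨h, hi⟩)
        · exact Or.inl (Or.inl ⟨h, hi⟩)
        · exact Or.inr (by rw [(hres w hw v hv).1 hi])
      · rintro ((h | h) | rfl)
        · exact ⟨Or.inr (Or.inl h.1), h.2⟩
        · exact ⟨Or.inl h.1, h.2⟩
        · exact ⟨Or.inr (Or.inr ⟨v, hv, rfl⟩), (hres v hv v hv).2 rfl⟩
    rw [h, Finset.sum_union, Finset.sum_union, Finset.sum_singleton, idxR v hv, hP]
    · congr 1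
      congr 1
      · refine Finset.sum_congr rfl fun y hy => ?_
        rw [idxY y (Finset.mem_filter.1 hy).1]
        push_cast; ring
      · refine Finset.sum_congr rfl fun x hx => ?_
        rw [idxX x (Finset.mem_filter.1 hx).1]
    · exact Finset.disjoint_filter_filter hXY.symm
    · simp [hresX v hv, hresY v hv]
  have PH : ∀ v ∈ H, α + s ≤ P v := by
    intro v hv
    obtain ⟨y, hy, hiy⟩ := hbig v hv
    have h1 : (α + s + before pos Y y : ℝ) ≤ ∑ y ∈ Y.filter (inc v), (α + s + before pos Y y) :=
      Finset.single_le_sum (f := fun y => (α + s + before pos Y y : ℝ))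
        (fun i _ => by positivity) (Finset.mem_filter.2 ⟨hy, hiy⟩)
    have h2 : 0 ≤ ∑ e ∈ X.filter (inc v), (α + g e : ℝ) :=
      Finset.sum_nonneg fun i _ => by positivity
    have h3 : (0 : ℝ) ≤ before pos Y y := by positivity
    rw [hP]
    linarith
  have sumL : ∀ w e, e ∈ E → (e ∈ Y → before pos Y e = 0) → E.filter (inc w) = {e} →
      ∑ e ∈ E.filter (inc w), (α + idx e) ≤ α + s := by
    intro w e he hY h
    rw [h, Finset.sum_singleton]
    have : idx e ≤ s := by
      rcases (hE e).1 he with he | he | ⟨v, hv, rfl⟩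
      · rw [idxX e he]; exact (hgs e he).le
      · rw [idxY e he, hY he]; rfl
      · rw [idxR v hv]; exact (hqs v hv).le
    have : (idx e : ℝ) ≤ s := by exact_mod_cast this
    linarith
  have neDH : ∀ v ∈ H, ∀ x ∈ X, ∀ y ∈ Y, pos y ≤ pos x + 1 → pos x ≤ pos y + 1 →
      P v + (α + q v) ≠ (α + g x) + (α + s + before pos Y y) := by
    intro v hv x hx y hy h1 h2 h
    have h3 : (before pos Y y : ℝ) ≤ before pos Y x := by
      exact_mod_cast before_le_of_pos_eq_succ hXY hpos hx h1
    have h4 : (before pos Y x : ℝ) ≤ before pos Y y + 1 := by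
      exact_mod_cast before_le_succ_of_pos_le hposY hy h2
    rcases le_or_gt (P v) (α + s + before pos Y x - 1) with h' | h'
    · have : (q v + 1 : ℝ) ≤ g x := by exact_mod_cast hqg v hv x hx h'
      linarith
    · have : (g x + 1 : ℝ) ≤ q v := by exact_mod_cast hgq v hv x hx h'
      linarith
  have ltDD : ∀ x ∈ X, ∀ y ∈ Y, ∀ x' ∈ X, ∀ y' ∈ Y, pos y ≤ pos x + 1 → pos x' ≤ pos y' + 1 →
      pos x < pos x' → (α + g x) + (α + s + before pos Y y) <
        (α + g x') + (α + s + before pos Y y') := by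
    intro x hx y hy x' hx' y' hy' h1 h2 h
    have h3 : (g x : ℝ) < g x' := by exact_mod_cast hgg x hx x' hx' h
    have h4 : pos y ≤ pos y' := by
      have : pos y' ≠ pos x := fun h => hXnot hx
        (hpos (by simp [hy']) (by simp [hx]) h ▸ hy')
      omega
    have h5 : (before pos Y y : ℝ) ≤ before pos Y y' := by exact_mod_cast before_mono h4
    linarith
  intro v w hvw
  dsimp only at hvw
  by_contra hne
  have hfil : E.filter (inc v) ≠ E.filter (inc w) := fun h => hne (hinj h)
  have s0 : ∀ x : ε, (0 : ℝ) ≤ before pos Y x := fun x => by positivity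
  have g0 : ∀ x : ε, (0 : ℝ) ≤ g x := fun x => by positivity
  have q0 : ∀ x : V, (0 : ℝ) ≤ q x := fun x => by positivity
  by_cases hv : v ∈ H <;> by_cases hw : w ∈ H
  · rw [sumH v hv, sumH w hw] at hvw
    rcases hqq v hv w hw hne with ⟨h1, h2⟩ | ⟨h1, h2⟩
    all_goals
      rw [← Nat.cast_lt (α := ℝ)] at h2
      linarith
  · rw [sumH v hv] at hvw
    rcases hrest w hw with ⟨x, hx, y, hy, h1, h2⟩ | ⟨e, he, h1, h2⟩
    · rw [sumD w x y hx hy h2] at hvw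
      exact neDH v hv x hx y hy h1.1 h1.2 hvw
    · have := sumL w e he h1 h2
      linarith [PH v hv, q0 v]
  · rw [sumH w hw] at hvw
    rcases hrest v hv with ⟨x, hx, y, hy, h1, h2⟩ | ⟨e, he, h1, h2⟩
    · rw [sumD v x y hx hy h2] at hvw
      exact neDH w hw x hx y hy h1.1 h1.2 hvw.symm
    · have := sumL v e he h1 h2
      linarith [PH w hw, q0 w]
  · rcases hrest v hv with ⟨x, hx, y, hy, h1, h2⟩ | ⟨e, he, h1, h2⟩ <;>
      rcases hrest w hw with ⟨x', hx', y', hy', h1', h2'⟩ | ⟨e', he', h1', h2'⟩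
    · rw [sumD v x y hx hy h2, sumD w x' y' hx' hy' h2'] at hvw
      rcases lt_trichotomy (pos x) (pos x') with h | h | h
      · exact (ltDD x hx y hy x' hx' y' hy' h1.1 h1'.2 h).ne hvw
      · obtain rfl := hposX hx hx' h
        have hyy : before pos Y y = before pos Y y' := by
          have : (before pos Y y : ℝ) = before pos Y y' := by linarith
          exact_mod_cast this
        exact hfil (by rw [h2, h2', bne y hy y' hy' hyy])
      · exact (ltDD x' hx' y' hy' x hx y hy h1'.1 h1.2 h).ne hvw.symm
    · have := sumL w e' he' h1' h2'
      rw [sumD v x y hx hy h2] at hvw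
      linarith [s0 y, g0 x]
    · have := sumL v e he h1 h2
      rw [sumD w x' y' hx' hy' h2'] at hvw
      linarith [s0 y', g0 x']
    · rw [h2, h2', Finset.sum_singleton, Finset.sum_singleton] at hvw
      have : (idx e : ℝ) = idx e' := by linarith
      exact hfil (by rw [h2, h2', hinjOn he he' (by exact_mod_cast this)])

theorem SimpleGraph.Connected.mem_of_adj_closed {V : Type*} {G : SimpleGraph V}
    (hG : G.Connected) {S : Set V} {u : V}
    (hu : u ∈ S) (hS : ∀ v ∈ S, ∀ w, G.Adj v w → w ∈ S) (w : V) : w ∈ S := by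
  obtain ⟨p⟩ := hG.preconnected u w
  induction p with
  | nil => exact hu
  | cons h _ ih => exact ih (hS _ hu _ h)

section Threads

variable {V : Type*}

/-- `T` lists the edges of a walk from `a` to `b` whose inner vertices lie in `D`. -/
inductive IsThread (G : SimpleGraph V) (D : Set V) : V → List (Sym2 V) → V → Prop
  | single {a b : V} : G.Adj a b → IsThread G D a [s(a, b)] b
  | cons {a u b : V} {T : List (Sym2 V)} : G.Adj a u → u ∈ D → IsThread G D u T b →
      IsThread G D a (s(a, u) :: T) b

namespace IsThread

variable {G : SimpleGraph V} {D : Set V} {a b : V} {T : List (Sym2 V)}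

theorem exists_eq_cons (h : IsThread G D a T b) : ∃ e T', T = e :: T' ∧ a ∈ e := by
  cases h <;> simp

theorem snoc {c : V} (h : IsThread G D a T b) (hb : b ∈ D) (hbc : G.Adj b c) :
    IsThread G D a (T ++ [s(b, c)]) c := by
  induction h with
  | single h => exact .cons h hb (.single hbc)
  | cons h hu _ ih => exact .cons h hu (ih hb hbc)

theorem reverse (h : IsThread G D a T b) : IsThread G D b T.reverse a := by
  induction h with
  | single h => simpa [Sym2.eq_swap] using IsThread.single (D := D) h.symm
  | cons h hu _ ih =>
    rw [List.reverse_cons, Sym2.eq_swap]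
    exact ih.snoc hu h.symm

theorem mem_cases (h : IsThread G D a T b) {w : V} {e : Sym2 V} (he : e ∈ T) (hw : w ∈ e) :
    (w = a ∧ T.head? = some e) ∨ (w = b ∧ T.getLast? = some e) ∨
      (w ∈ D ∧ ∃ A e₁ e₂ B, T = A ++ e₁ :: e₂ :: B ∧ w ∈ e₁ ∧ w ∈ e₂) := by
  induction h with
  | single h =>
    obtain rfl := List.mem_singleton.1 he
    rcases Sym2.mem_iff.1 hw with rfl | rfl <;> simp
  | @cons a u b T h hu hT ih =>
    obtain ⟨e', T', rfl, he'⟩ := hT.exists_eq_cons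
    rcases List.mem_cons.1 he with rfl | he
    · rcases Sym2.mem_iff.1 hw with rfl | rfl
      · simp
      · exact Or.inr (Or.inr ⟨hu, [], _, e', T', rfl, by simp, he'⟩)
    · rcases ih he with ⟨rfl, h1⟩ | ⟨rfl, h1⟩ | ⟨h1, A, e₁, e₂, B, h2, h3⟩
      · exact Or.inr (Or.inr ⟨hu, [], _, e', T', rfl, by simp, he'⟩)
      · exact Or.inr (Or.inl ⟨rfl, by rw [List.getLast?_cons_cons]; exact h1⟩)
      · exact Or.inr (Or.inr ⟨h1, s(a, u) :: A, e₁, e₂, B, by rw [h2]; rfl, h3⟩)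

/-- If each vertex with two edges on a thread chooses a different edge and the first vertex chooses
the first edge, then the last edge is not chosen by the last vertex. -/
theorem getLast_eq_choice (h : IsThread G D a T b) {f : V → Sym2 V}
    (hnd : T.Nodup) (hf : ∀ v ∈ D, ∀ e₁ e₂, e₁ ∈ T → e₂ ∈ T → e₁ ≠ e₂ →
      v ∈ e₁ → v ∈ e₂ → f v ≠ e₁ → f v = e₂)
    (hinj : ∀ v ∈ D, ∀ w, (w = a ∨ w ∈ D) → w ≠ v → f w ≠ f v)
    (hfa : T.head? = some (f a)) :
    ∃ u, u ≠ b ∧ (u = a ∨ u ∈ D) ∧ T.getLast? = some (f u) := by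
  induction h with
  | @single a b h => exact ⟨a, h.ne, Or.inl rfl, by simpa using hfa⟩
  | @cons a u b T h hu hT ih =>
    obtain ⟨e', T', rfl, he'⟩ := hT.exists_eq_cons
    have hfa' : s(a, u) = f a := by simpa using hfa
    have hne : s(a, u) ≠ e' := by rintro rfl; simp at hnd
    have hfu : f u = e' := hf u hu s(a, u) e' (by simp) (by simp) hne (by simp) he'
      (by rw [hfa']; exact fun h' => hinj u hu a (Or.inl rfl) h.ne h'.symm)
    obtain ⟨v, hv, hv', hl⟩ := ih hnd.of_cons
      (fun v hv e₁ e₂ h1 h2 =>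
        hf v hv e₁ e₂ (List.mem_cons_of_mem _ h1) (List.mem_cons_of_mem _ h2))
      (fun v hv w hw => hinj v hv w (Or.inr (hw.elim (fun h => h ▸ hu) id))) (by simp [hfu])
    exact ⟨v, hv, Or.inr (hv'.elim (fun h => h ▸ hu) id), by rw [List.getLast?_cons_cons]; exact hl⟩

end IsThread

end Threads

section Decomposition

variable {V : Type*} [Fintype V] {G : SimpleGraph V}

theorem mem_edgeFS {e : Sym2 V} : e ∈ edgeFS G ↔ e ∈ G.edgeSet := by
  simp [edgeFS]

theorem mk_mem_edgeFS {u v : V} : s(u, v) ∈ edgeFS G ↔ G.Adj u v := by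
  simp [edgeFS]

theorem card_filter_mem_edgeFS (v : V) :
    ((edgeFS G).filter fun e => v ∈ e).card = G.degree v := by
  rw [← G.card_incidenceFinset_eq_degree]
  congr 1
  ext e
  simp [mem_edgeFS, SimpleGraph.incidenceSet]

theorem exists_filter_eq_pair {v : V} (h : G.degree v = 2) :
    ∃ e₁ e₂, e₁ ≠ e₂ ∧ (edgeFS G).filter (fun e => v ∈ e) = {e₁, e₂} :=
  Finset.card_eq_two.1 ((card_filter_mem_edgeFS v).trans h)

theorem filter_eq_pair {v : V} (h : G.degree v = 2) {e₁ e₂ : Sym2 V} (hne : e₁ ≠ e₂)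
    (h₁ : e₁ ∈ edgeFS G) (h₂ : e₂ ∈ edgeFS G) (hv₁ : v ∈ e₁) (hv₂ : v ∈ e₂) :
    (edgeFS G).filter (fun e => v ∈ e) = {e₁, e₂} := by
  symm
  apply Finset.eq_of_subset_of_card_le
  · intro e
    simp only [Finset.mem_insert, Finset.mem_singleton, Finset.mem_filter]
    rintro (rfl | rfl) <;> simp [*]
  · rw [card_filter_mem_edgeFS, h, Finset.card_pair hne]

theorem filter_eq_singleton {v : V} (h : G.degree v = 1) {e : Sym2 V}
    (he : e ∈ edgeFS G) (hv : v ∈ e) : (edgeFS G).filter (fun e => v ∈ e) = {e} := by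
  symm
  apply Finset.eq_of_subset_of_card_le
  · simp [he, hv]
  · rw [card_filter_mem_edgeFS, h, Finset.card_singleton]

/-- At each vertex of `D`, all edges or none belong to `W`. -/
def ClosedAt (G : SimpleGraph V) (D : Set V) (W : Finset (Sym2 V)) : Prop :=
  ∀ w ∈ D, ∀ e ∈ edgeFS G, ∀ e' ∈ edgeFS G, w ∈ e → w ∈ e' → e ∈ W → e' ∈ W

theorem exists_thread_extension {D : Set V} (hD : ∀ v ∈ D, G.degree v = 2) (W : Finset (Sym2 V))
    {u : V} (hu : u ∈ D) {e₀ : Sym2 V} (h₀ : e₀ ∈ W) (h₀E : e₀ ∈ edgeFS G) (hu₀ : u ∈ e₀)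
    (hfree : ∀ e ∈ edgeFS G, u ∈ e → e ≠ e₀ → e ∉ W) (hW : ClosedAt G (D \ {u}) W) :
    ∃ T b, IsThread G D u T b ∧ b ∉ D ∧ T.Nodup ∧ (∀ e ∈ T, e ∈ edgeFS G ∧ e ∉ W) ∧
      ClosedAt G D (W ∪ T.toFinset) := by
  obtain ⟨n, hn⟩ : ∃ n, n = (edgeFS G \ W).card := ⟨_, rfl⟩
  induction n using Nat.strong_induction_on generalizing W u e₀ with
  | _ n ih =>
    obtain ⟨e₁, h₁E, hu₁, hne⟩ : ∃ e₁ ∈ edgeFS G, u ∈ e₁ ∧ e₁ ≠ e₀ := by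
      obtain ⟨x, y, hxy, h⟩ := exists_filter_eq_pair (hD u hu)
      have hx : x ∈ (edgeFS G).filter fun e => u ∈ e := by simp [h]
      have hy : y ∈ (edgeFS G).filter fun e => u ∈ e := by simp [h]
      rw [Finset.mem_filter] at hx hy
      by_cases hx0 : x = e₀
      · exact ⟨y, hy.1, hy.2, fun h => hxy (hx0.trans h.symm)⟩
      · exact ⟨x, hx.1, hx.2, hx0⟩
    have h₁W := hfree e₁ h₁E hu₁ hne
    obtain ⟨u', rfl⟩ := Sym2.mem_iff_exists.1 hu₁
    have hadj : G.Adj u u' := mk_mem_edgeFS.1 h₁E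
    have hall : ∀ e ∈ edgeFS G, u ∈ e → e ∈ insert s(u, u') W := by
      intro e he hue
      have : e ∈ (edgeFS G).filter fun e => u ∈ e := by simp [he, hue]
      rw [filter_eq_pair (hD u hu) hne h₁E h₀E hu₁ hu₀] at this
      rcases (by simpa using this : e = s(u, u') ∨ e = e₀) with rfl | rfl <;> simp [h₀]
    have hclosed : ClosedAt G (D \ {u'}) (insert s(u, u') W) := by
      rintro w ⟨hw, hwu'⟩ e he e' he' hwe hwe' heW
      by_cases hwu : w = u
      · exact hall e' he' (hwu ▸ hwe')
      · rcases Finset.mem_insert.1 heW with rfl | heW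
        · rcases Sym2.mem_iff.1 hwe with h | h
          · exact absurd h hwu
          · exact absurd h hwu'
        · exact Finset.mem_insert_of_mem (hW w ⟨hw, hwu⟩ e he e' he' hwe hwe' heW)
    by_cases hu' : u' ∈ D
    · obtain ⟨T, b, hT, hb, hnd, hmem, hcl⟩ := ih _ (by
          rw [hn]
          apply Finset.card_lt_card
          rw [Finset.ssubset_iff_of_subset]
          · exact ⟨s(u, u'), by simp [h₁E, h₁W], by simp⟩
          · exact Finset.sdiff_subset_sdiff le_rfl (Finset.subset_insert _ _))
        (insert s(u, u') W) hu' (e₀ := s(u, u')) (by simp) h₁E (by simp) (by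
          intro e he hu'e hne' heW
          have heW := Finset.mem_of_mem_insert_of_ne heW hne'
          exact h₁W (hW u' ⟨hu', hadj.ne'⟩ e he _ h₁E hu'e (by simp) heW)) hclosed rfl
      refine ⟨s(u, u') :: T, b, .cons hadj hu' hT, hb, ?_, ?_, ?_⟩
      · exact List.nodup_cons.2 ⟨fun h => (hmem _ h).2 (by simp), hnd⟩
      · intro e he
        rcases List.mem_cons.1 he with rfl | he
        · exact ⟨h₁E, h₁W⟩
        · exact ⟨(hmem e he).1, fun h => (hmem e he).2 (by simp [h])⟩
      · convert hcl using 1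
        ext; simp
    · refine ⟨[s(u, u')], u', .single hadj, hu', by simp, by simp [h₁E, h₁W], ?_⟩
      rw [Set.sdiff_singleton_eq_self hu'] at hclosed
      convert hclosed using 1
      ext; simp

theorem exists_thread_of_edge {D : Set V} (hD : ∀ v ∈ D, G.degree v = 2) {U : Finset (Sym2 V)}
    (hU : ClosedAt G D U) {a c : V} (hac : G.Adj a c) (hacU : s(a, c) ∉ U) (ha : a ∉ D) :
    ∃ T b, IsThread G D a T b ∧ b ∉ D ∧ T.Nodup ∧ (∀ e ∈ T, e ∈ edgeFS G ∧ e ∉ U) ∧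
      ClosedAt G D (U ∪ T.toFinset) := by
  have hE := mk_mem_edgeFS.2 hac
  have hclosed : ClosedAt G (D \ {c}) (insert s(a, c) U) := by
    rintro w ⟨hw, hwc⟩ e he e' he' hwe hwe' heU
    rcases Finset.mem_insert.1 heU with rfl | heU
    · rcases Sym2.mem_iff.1 hwe with h | h
      · exact absurd (h ▸ hw) ha
      · exact absurd h hwc
    · exact Finset.mem_insert_of_mem (hU w hw e he e' he' hwe hwe' heU)
  by_cases hc : c ∈ D
  · obtain ⟨T, b, hT, hb, hnd, hmem, hcl⟩ := exists_thread_extension hD (insert s(a, c) U) hc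
      (e₀ := s(a, c)) (by simp) hE (by simp) (by
        intro e he hce hne heU
        exact hacU (hU c hc e he _ hE hce (by simp) (Finset.mem_of_mem_insert_of_ne heU hne)))
      hclosed
    refine ⟨s(a, c) :: T, b, .cons hac hc hT, hb, ?_, ?_, ?_⟩
    · exact List.nodup_cons.2 ⟨fun h => (hmem _ h).2 (by simp), hnd⟩
    · intro e he
      rcases List.mem_cons.1 he with rfl | he
      · exact ⟨hE, hacU⟩
      · exact ⟨(hmem e he).1, fun h => (hmem e he).2 (by simp [h])⟩
    · convert hcl using 1
      ext; simp
  · refine ⟨[s(a, c)], c, .single hac, hc, by simp, by simp [hE, hacU], ?_⟩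
    rw [Set.sdiff_singleton_eq_self hc] at hclosed
    convert hclosed using 1
    ext; simp

/-- The edges outside `U` are partitioned into threads between vertices outside `D`. -/
theorem exists_thread_decomposition (hG : G.Connected) {D : Set V}
    (hD : ∀ v ∈ D, G.degree v = 2) {r : V} (hr : r ∉ D) (U : Finset (Sym2 V))
    (hU : ClosedAt G D U) :
    ∃ 𝒯 : List (List (Sym2 V)), 𝒯.flatten.Nodup ∧ (∀ e, e ∈ 𝒯.flatten ↔ e ∈ edgeFS G ∧ e ∉ U) ∧
      ∀ T ∈ 𝒯, ∃ a b, IsThread G D a T b ∧ a ∉ D ∧ b ∉ D := by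
  obtain ⟨n, hn⟩ : ∃ n, n = (edgeFS G \ U).card := ⟨_, rfl⟩
  induction n using Nat.strong_induction_on generalizing U with
  | _ n ih =>
    by_cases hfull : ∀ e ∈ edgeFS G, e ∈ U
    · exact ⟨[], by simp, by simpa using hfull, by simp⟩
    obtain ⟨a, c, hac, hacU, ha⟩ : ∃ a c, G.Adj a c ∧ s(a, c) ∉ U ∧ a ∉ D := by
      by_contra! hcon
      obtain ⟨e, he, heU⟩ := not_forall₂.1 hfull
      induction e using Sym2.ind with
      | _ x y =>
        have hxy := mk_mem_edgeFS.1 he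
        refine hr (hG.mem_of_adj_closed (S := {v | v ∈ D ∧ ∃ z, G.Adj v z ∧ s(v, z) ∉ U})
          (u := x) ⟨hcon x y hxy heU, y, hxy, heU⟩ ?_ r).1
        rintro v ⟨hv, z, hvz, hvzU⟩ w hvw
        have hvwU : s(w, v) ∉ U := fun h => hvzU
          (hU v hv s(w, v) (mk_mem_edgeFS.2 hvw.symm) _ (mk_mem_edgeFS.2 hvz) (by simp) (by simp) h)
        exact ⟨hcon w v hvw.symm hvwU, v, hvw.symm, hvwU⟩
    obtain ⟨T, b, hT, hb, hnd, hmem, hcl⟩ := exists_thread_of_edge hD hU hac hacU ha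
    obtain ⟨e, T', hTe, -⟩ := hT.exists_eq_cons
    have heT : e ∈ T := by simp [hTe]
    obtain ⟨𝒯, h1, h2, h3⟩ := ih _ (by
      rw [hn]
      apply Finset.card_lt_card
      rw [Finset.ssubset_iff_of_subset]
      · exact ⟨e, by simp [(hmem e heT).1, (hmem e heT).2], by simp [heT]⟩
      · exact Finset.sdiff_subset_sdiff le_rfl Finset.subset_union_left) _ hcl rfl
    refine ⟨T :: 𝒯, ?_, ?_, ?_⟩
    · rw [List.flatten_cons, List.nodup_append']
      refine ⟨hnd, h1, fun x hx hx' => ?_⟩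
      exact ((h2 x).1 hx').2 (by simp [hx])
    · intro x
      rw [List.flatten_cons, List.mem_append, h2]
      have := hmem x
      simp only [Finset.mem_union, List.mem_toFinset]
      tauto
    · intro T₁ hT₁
      rcases List.mem_cons.1 hT₁ with rfl | hT₁
      · exact ⟨a, b, hT, ha, hb⟩
      · exact h3 T₁ hT₁

end Decomposition

section Choice

variable {V : Type*} [Fintype V] {G : SimpleGraph V}

/-- `res` assigns to each vertex of `H` a pendant edge at that vertex. -/
def IsReservation (G : SimpleGraph V) (H : Finset V) (res : V → Sym2 V) : Prop :=
  ∀ v ∈ H, 3 ≤ G.degree v ∧ ∃ l, res v = s(v, l) ∧ G.Adj v l ∧ G.degree l = 1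

theorem IsReservation.mem_edgeFS {H : Finset V} {res : V → Sym2 V} (h : IsReservation G H res)
    {v : V} (hv : v ∈ H) : res v ∈ edgeFS G := by
  obtain ⟨-, l, hl, hvl, -⟩ := h v hv
  exact hl ▸ mk_mem_edgeFS.2 hvl

theorem IsReservation.mem {H : Finset V} {res : V → Sym2 V} (h : IsReservation G H res)
    {v : V} (hv : v ∈ H) : v ∈ res v := by
  obtain ⟨-, l, hl, -⟩ := h v hv
  simp [hl]

theorem IsReservation.eq_of_mem {H : Finset V} {res : V → Sym2 V} (h : IsReservation G H res)
    {v w : V} (hv : v ∈ H) (hw : 2 ≤ G.degree w) (hwv : w ∈ res v) : w = v := by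
  obtain ⟨-, l, hl, -, hl1⟩ := h v hv
  rw [hl] at hwv
  rcases Sym2.mem_iff.1 hwv with h | rfl
  · exact h
  · omega

/-- Each vertex of degree at least two chooses one of its edges outside `R`, no edge is chosen twice,
and the only chosen edge that may contain a leaf is `ρ`. -/
structure IsChoice (G : SimpleGraph V) (R : Finset (Sym2 V)) (f : V → Sym2 V) (ρ : Sym2 V) :
    Prop where
  spec : ∀ v, 2 ≤ G.degree v → f v ∈ edgeFS G ∧ f v ∉ R ∧ v ∈ f v
  inj : ∀ v w, 2 ≤ G.degree v → 2 ≤ G.degree w → f v = f w → v = w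
  eq_of_leaf : ∀ v w, 2 ≤ G.degree v → w ∈ f v → G.degree w = 1 → f v = ρ

theorem exists_edge_choice_of_leaf (hG : G.Connected) {H : Finset V} {res : V → Sym2 V}
    (hres : IsReservation G H res) {r p : V} (hr : G.degree r = 1) (hrp : G.Adj r p)
    (hrpH : s(r, p) ∉ H.image res) :
    ∃ f : V → Sym2 V, IsChoice G (H.image res) f s(r, p) := by
  have hleaf : ∀ {v x y}, G.degree v = 1 → G.Adj v x → G.Adj v y → x = y := by
    intro v x y hv hx hy
    obtain ⟨z, hz⟩ := Finset.card_eq_one.1 hv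
    rw [← SimpleGraph.mem_neighborFinset, hz, Finset.mem_singleton] at hx hy
    rw [hx, hy]
  have hnext : ∀ v, ∃ u, v ≠ r → G.Adj v u ∧ G.dist u r + 1 = G.dist v r := by
    intro v
    by_cases hv : v = r
    · exact ⟨v, fun h => absurd hv h⟩
    obtain ⟨q, hq⟩ := hG.exists_walk_length_eq_dist v r
    cases q with
    | nil => exact absurd rfl hv
    | @cons _ u _ h q =>
      refine ⟨u, fun _ => ⟨h, ?_⟩⟩
      have h1 := SimpleGraph.dist_le q
      have h2 : G.dist v r ≤ G.dist u r + 1 := by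
        obtain ⟨q', hq'⟩ := hG.exists_walk_length_eq_dist u r
        rw [← hq']
        exact SimpleGraph.dist_le (.cons h q')
      rw [SimpleGraph.Walk.length_cons] at hq
      omega
  choose nxt hnxt using hnext
  have hner : ∀ {v}, 2 ≤ G.degree v → v ≠ r := by rintro v hv rfl; omega
  have hleafnxt : ∀ v, 2 ≤ G.degree v → G.degree (nxt v) = 1 → s(v, nxt v) = s(r, p) := by
    intro v hv h1
    obtain ⟨hadj, hd⟩ := hnxt v (hner hv)
    have hnr : nxt v = r := by
      by_contra hne
      obtain ⟨hadj', hd'⟩ := hnxt _ hne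
      have := hleaf h1 hadj' hadj.symm
      rw [this] at hd'
      omega
    rw [hnr] at hadj ⊢
    rw [hleaf hr hadj.symm hrp, Sym2.eq_swap]
  refine ⟨fun v => s(v, nxt v), ?_, ?_, ?_⟩
  · intro v hv
    have hadj := (hnxt v (hner hv)).1
    refine ⟨mk_mem_edgeFS.2 hadj, fun h => ?_, by simp⟩
    obtain ⟨w, hw, hwv⟩ := Finset.mem_image.1 h
    obtain rfl := hres.eq_of_mem hw hv (by simp [hwv])
    obtain ⟨-, l, hl, -, hl1⟩ := hres v hw
    have : nxt v = l := by
      rw [hl] at hwv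
      rcases Sym2.eq_iff.1 hwv with h' | h'
      · exact h'.2.symm
      · exact (h'.2.trans h'.1).symm
    exact hrpH (hleafnxt v hv (this ▸ hl1) ▸ h)
  · intro v w hv hw h
    rcases Sym2.eq_iff.1 h with h' | h'
    · exact h'.1
    · have h1 := (hnxt v (hner hv)).2
      have h2 := (hnxt w (hner hw)).2
      rw [h'.2] at h1
      rw [← h'.1] at h2
      omega
  · intro v w hv hw h1
    rcases Sym2.mem_iff.1 hw with rfl | rfl
    · omega
    · exact hleafnxt v hv h1

theorem exists_edge_choice (hG : G.Connected) {H : Finset V} {res : V → Sym2 V}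
    (hres : IsReservation G H res) :
    ∃ (f : V → Sym2 V) (ρ : Sym2 V), IsChoice G (H.image res) f ρ := by
  by_cases hex : ∃ r p, G.degree r = 1 ∧ G.Adj r p ∧ s(r, p) ∉ H.image res
  · obtain ⟨r, p, hr, hrp, hrpH⟩ := hex
    obtain ⟨f, h⟩ := exists_edge_choice_of_leaf hG hres hr hrp hrpH
    exact ⟨f, _, h⟩
  push Not at hex
  set E' := edgeFS G \ H.image res with hE'
  have hdeg : ∀ v, 2 ≤ G.degree v → 2 ≤ (E'.filter fun e => v ∈ e).card := by
    intro v hv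
    by_cases hvH : v ∈ H
    · have hsub : (edgeFS G).filter (fun e => v ∈ e) ⊆
          insert (res v) (E'.filter fun e => v ∈ e) := by
        intro e
        simp only [Finset.mem_filter, Finset.mem_insert, hE', Finset.mem_sdiff, Finset.mem_image]
        rintro ⟨he, hve⟩
        by_cases h : ∃ w ∈ H, res w = e
        · obtain ⟨w, hw, rfl⟩ := h
          exact Or.inl (by rw [hres.eq_of_mem hw hv hve])
        · exact Or.inr ⟨⟨he, h⟩, hve⟩
      have h1 := (Finset.card_le_card hsub).trans (Finset.card_insert_le _ _)
      rw [card_filter_mem_edgeFS] at h1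
      have := (hres v hvH).1
      omega
    · rw [← card_filter_mem_edgeFS] at hv
      refine hv.trans (Finset.card_le_card fun e => ?_)
      simp only [Finset.mem_filter, hE', Finset.mem_sdiff, Finset.mem_image]
      rintro ⟨he, hve⟩
      refine ⟨⟨he, ?_⟩, hve⟩
      rintro ⟨w, hw, rfl⟩
      rw [card_filter_mem_edgeFS] at hv
      exact hvH (hres.eq_of_mem hw hv hve ▸ hw)
  have hall : ∀ s : Finset {v // 2 ≤ G.degree v},
      s.card ≤ (s.biUnion fun v => E'.filter fun e => v.1 ∈ e).card := by
    intro s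
    refine Nat.le_of_mul_le_mul_right (c := 2) ?_ two_pos
    refine Finset.card_mul_le_card_mul (fun (v : {v // 2 ≤ G.degree v}) e => v.1 ∈ e) ?_ ?_
    · intro v hv
      refine (hdeg v.1 v.2).trans (Finset.card_le_card fun e he => ?_)
      rw [Finset.mem_bipartiteAbove]
      exact ⟨Finset.mem_biUnion.2 ⟨v, hv, he⟩, (Finset.mem_filter.1 he).2⟩
    · intro e _
      induction e using Sym2.ind with
      | _ x y =>
        have : ((s.bipartiteBelow (fun (v : {v // 2 ≤ G.degree v}) e => v.1 ∈ e) s(x, y)).map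
            (Function.Embedding.subtype _)) ⊆ {x, y} := by
          intro v
          simp only [Finset.mem_map, Finset.mem_bipartiteBelow]
          rintro ⟨v, ⟨-, h⟩, rfl⟩
          simpa using h
        have h2 := Finset.card_le_card this
        rw [Finset.card_map] at h2
        exact h2.trans Finset.card_le_two
  obtain ⟨g, hg, hgmem⟩ := (Finset.all_card_le_biUnion_card_iff_exists_injective _).1 hall
  obtain ⟨v₀⟩ := hG.nonempty
  refine ⟨fun v => if h : 2 ≤ G.degree v then g ⟨v, h⟩ else s(v₀, v₀), s(v₀, v₀), ?_, ?_, ?_⟩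
  · intro v hv
    have := hgmem ⟨v, hv⟩
    simp only [hE', Finset.mem_filter, Finset.mem_sdiff] at this
    simpa only [dif_pos hv] using ⟨this.1.1, this.1.2, this.2⟩
  · intro v w hv hw h
    simp only [dif_pos hv, dif_pos hw] at h
    exact congrArg Subtype.val (hg h)
  · intro v w hv hw h1
    exfalso
    simp only [dif_pos hv] at hw
    have := hgmem ⟨v, hv⟩
    simp only [hE', Finset.mem_filter, Finset.mem_sdiff] at this
    obtain ⟨z, hz⟩ := Sym2.mem_iff_exists.1 hw
    rw [hz] at this
    exact this.1.2 (hex w z h1 (mk_mem_edgeFS.1 this.1.1))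

end Choice

section Alternate

variable {ε : Type*}

/-- The elements of the list, coloured alternately, beginning with `c`. -/
def alternate : Bool → List ε → List (ε × Bool)
  | _, [] => []
  | c, e :: T => (e, c) :: alternate (!c) T

theorem map_fst_alternate (c : Bool) (T : List ε) : (alternate c T).map Prod.fst = T := by
  induction T generalizing c with
  | nil => rfl
  | cons e T ih => simp [alternate, ih]

theorem mem_of_mem_alternate {c c' : Bool} {T : List ε} {e : ε} (h : (e, c') ∈ alternate c T) :
    e ∈ T := by
  rw [← map_fst_alternate c T]
  exact List.mem_map_of_mem (f := Prod.fst) h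

theorem eq_of_mem_of_nodup_map_fst {L : List (ε × Bool)} (h : (L.map Prod.fst).Nodup)
    {e : ε} {c c' : Bool} (hc : (e, c) ∈ L) (hc' : (e, c') ∈ L) : c = c' := by
  have := List.inj_on_of_nodup_map h hc hc' rfl
  exact congrArg Prod.snd this

theorem mem_alternate_of_head {T : List ε} {e : ε} (c : Bool) (h : T.head? = some e) :
    (e, c) ∈ alternate c T := by
  cases T with
  | nil => simp at h
  | cons x T => simp_all [alternate]

theorem mem_alternate_of_getLast {T : List ε} {e : ε} (c : Bool) (h : T.getLast? = some e) :
    (e, if T.length % 2 = 1 then c else !c) ∈ alternate c T := by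
  induction T generalizing c with
  | nil => simp at h
  | cons x T ih =>
    cases T with
    | nil => simp_all [alternate]
    | cons y T =>
      rw [List.getLast?_cons_cons] at h
      have := ih (!c) h
      rw [alternate, List.mem_cons]
      right
      rw [List.length_cons]
      rcases Nat.mod_two_eq_zero_or_one (y :: T).length with h' | h'
      · rw [h'] at this
        rw [Nat.add_mod, h']
        simpa using this
      · rw [h'] at this
        rw [Nat.add_mod, h']
        simpa using this

theorem mem_alternate_of_consecutive {A B : List ε} {e₁ e₂ : ε} (c : Bool) :
    ∃ c', (e₁, c') ∈ alternate c (A ++ e₁ :: e₂ :: B) ∧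
      (e₂, !c') ∈ alternate c (A ++ e₁ :: e₂ :: B) := by
  induction A generalizing c with
  | nil => exact ⟨c, by simp [alternate]⟩
  | cons x A ih =>
    obtain ⟨c', h1, h2⟩ := ih (!c)
    exact ⟨c', List.mem_cons_of_mem _ h1, List.mem_cons_of_mem _ h2⟩

theorem countP_prefix_alternate {c : Bool} {T : List ε} {A B : List (ε × Bool)}
    (h : alternate c T = A ++ B) :
    A.countP (fun p => p.2) ≤ A.countP (fun p => !p.2) + if c then 1 else 0 := by
  induction T generalizing c A with
  | nil =>
    rw [alternate, List.nil_eq_append_iff] at h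
    simp [h.1]
  | cons e T ih =>
    cases A with
    | nil => simp
    | cons x A =>
      rw [alternate, List.cons_append, List.cons.injEq] at h
      obtain ⟨rfl, h⟩ := h
      have := ih h
      cases c <;> simp_all

end Alternate

section Orientation

variable {V : Type*} [Fintype V] {G : SimpleGraph V} {R : Finset (Sym2 V)} {f : V → Sym2 V}
  {ρ : Sym2 V}

/-- A thread together with the colour of its first edge, suitable for the colouring of the edges:
`true` stands for the big edges. -/
structure IsBlock (G : SimpleGraph V) (f : V → Sym2 V) (ρ : Sym2 V) (c : Bool)
    (T : List (Sym2 V)) : Prop where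
  thread : ∃ a b, IsThread G {v | G.degree v = 2} a T b ∧ G.degree a ≠ 2 ∧ G.degree b ≠ 2
  choice : ∀ v, 3 ≤ G.degree v → f v ∈ T → (f v, true) ∈ alternate c T
  inner : c = true → ∀ e v, 3 ≤ G.degree v → v ∈ e → (e, false) ∉ alternate c T
  leaf : ∀ w e, G.degree w = 1 → w ∈ e → e ∈ T →
    (e, false) ∈ alternate c T ∨ (c = true ∧ T.head? = some e ∧ e = ρ)

theorem IsThread.isBlock_of_getLast (hf : IsChoice G R f ρ) {a b : V} {T : List (Sym2 V)}
    (hT : IsThread G {v | G.degree v = 2} a T b) (hnd : T.Nodup) (hTE : ∀ e ∈ T, e ∈ edgeFS G)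
    (ha : G.degree a ≠ 2) (hb : 3 ≤ G.degree b) (hfb : T.getLast? = some (f b)) :
    IsBlock G f ρ (decide (T.length % 2 = 1)) T := by
  obtain ⟨u, hua, hu, hfu⟩ := hT.reverse.getLast_eq_choice (f := f) (List.nodup_reverse.2 hnd)
    (by
      intro v hv e₁ e₂ h₁ h₂ hne hv₁ hv₂ hfv
      rw [List.mem_reverse] at h₁ h₂
      have hv' : G.degree v = 2 := hv
      have hs := hf.spec v hv'.ge
      have : f v ∈ (edgeFS G).filter fun e => v ∈ e := Finset.mem_filter.2 ⟨hs.1, hs.2.2⟩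
      rw [filter_eq_pair hv' hne (hTE _ h₁) (hTE _ h₂) hv₁ hv₂] at this
      simpa [hfv] using this)
    (by
      intro v hv w hw hne h
      have hv' : G.degree v = 2 := hv
      have hw' : 2 ≤ G.degree w := by
        rcases hw with rfl | hw
        · omega
        · exact (show G.degree w = 2 from hw).ge
      exact hne (hf.inj w v hw' hv'.ge h))
    (by rw [List.head?_reverse, hfb])
  rw [List.getLast?_reverse] at hfu
  have hu2 : 2 ≤ G.degree u := by
    rcases hu with rfl | hu
    · omega
    · exact (show G.degree u = 2 from hu).ge
  have hlast := mem_alternate_of_getLast (decide (T.length % 2 = 1)) hfb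
  have hlast' : (f b, true) ∈ alternate (decide (T.length % 2 = 1)) T := by
    convert hlast using 2
    split_ifs with h <;> simp [h]
  have hcol : ∀ {e c c'}, (e, c) ∈ alternate (decide (T.length % 2 = 1)) T →
      (e, c') ∈ alternate (decide (T.length % 2 = 1)) T → c = c' := fun h h' =>
    eq_of_mem_of_nodup_map_fst (by rwa [map_fst_alternate]) h h'
  refine ⟨⟨a, b, hT, ha, by omega⟩, ?_, ?_, ?_⟩
  · intro v hv hvT
    rcases hT.mem_cases hvT (hf.spec v (by omega)).2.2 with ⟨rfl, h⟩ | ⟨rfl, h⟩ | ⟨h, -⟩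
    · rw [hfu, Option.some.injEq] at h
      exact absurd (hf.inj u v hu2 (by omega) h) hua
    · exact hlast'
    · have : G.degree v = 2 := h
      omega
  · intro hc e v hv hve he
    rcases hT.mem_cases (mem_of_mem_alternate he) hve with ⟨rfl, h⟩ | ⟨rfl, h⟩ | ⟨h, -⟩
    · have := mem_alternate_of_head (decide (T.length % 2 = 1)) h
      exact absurd ((hcol he this).trans hc) (by simp)
    · rw [hfb, Option.some.injEq] at h
      exact absurd (hcol he (h ▸ hlast')) (by simp)
    · have : G.degree v = 2 := h
      omega
  · intro w e hw hwe he
    rcases hT.mem_cases he hwe with ⟨rfl, h⟩ | ⟨rfl, h⟩ | ⟨h, -⟩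
    · by_cases hc : T.length % 2 = 1
      · right
        refine ⟨by simp [hc], h, ?_⟩
        rw [hfu, Option.some.injEq] at h
        rw [← h]
        exact hf.eq_of_leaf u w hu2 (h ▸ hwe) hw
      · left
        convert mem_alternate_of_head (decide (T.length % 2 = 1)) h
        simp [hc]
    · omega
    · have : G.degree w = 2 := h
      omega

theorem IsThread.exists_isBlock (hf : IsChoice G R f ρ) {a b : V} {T : List (Sym2 V)}
    (hT : IsThread G {v | G.degree v = 2} a T b) (hnd : T.Nodup) (hTE : ∀ e ∈ T, e ∈ edgeFS G)
    (ha : G.degree a ≠ 2) (hb : G.degree b ≠ 2) (hab : G.degree a = 1 → G.degree b ≠ 1) :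
    ∃ c T', T'.Perm T ∧ IsBlock G f ρ c T' := by
  have hTE' : ∀ e ∈ T.reverse, e ∈ edgeFS G := fun e he => hTE e (List.mem_reverse.1 he)
  by_cases hB : 3 ≤ G.degree b ∧ T.getLast? = some (f b)
  · exact ⟨_, T, .rfl, hT.isBlock_of_getLast hf hnd hTE ha hB.1 hB.2⟩
  by_cases hA : 3 ≤ G.degree a ∧ T.head? = some (f a)
  · exact ⟨_, T.reverse, T.reverse_perm, hT.reverse.isBlock_of_getLast hf
      (List.nodup_reverse.2 hnd) hTE' hb hA.1 (by rw [List.getLast?_reverse, hA.2])⟩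
  have hno : ∀ v, 3 ≤ G.degree v → f v ∉ T := by
    intro v hv hvT
    rcases hT.mem_cases hvT (hf.spec v (by omega)).2.2 with ⟨rfl, h⟩ | ⟨rfl, h⟩ | ⟨h, -⟩
    · exact hA ⟨hv, h⟩
    · exact hB ⟨hv, h⟩
    · have : G.degree v = 2 := h
      omega
  by_cases hb1 : G.degree b = 1
  · refine ⟨false, T.reverse, T.reverse_perm, ⟨⟨b, a, hT.reverse, hb, ha⟩, ?_, by simp, ?_⟩⟩
    · exact fun v hv h => absurd (List.mem_reverse.1 h) (hno v hv)
    · intro w e hw hwe he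
      rcases hT.reverse.mem_cases he hwe with ⟨rfl, h⟩ | ⟨rfl, h⟩ | ⟨h, -⟩
      · exact Or.inl (mem_alternate_of_head _ h)
      · exact absurd hb1 (hab hw)
      · have : G.degree w = 2 := h
        omega
  · refine ⟨false, T, .rfl, ⟨⟨a, b, hT, ha, hb⟩, ?_, by simp, ?_⟩⟩
    · exact fun v hv h => absurd h (hno v hv)
    · intro w e hw hwe he
      rcases hT.mem_cases he hwe with ⟨rfl, h⟩ | ⟨rfl, h⟩ | ⟨h, -⟩
      · exact Or.inl (mem_alternate_of_head _ h)
      · exact absurd hw hb1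
      · have : G.degree w = 2 := h
        omega

end Orientation

section Order

variable {ε : Type*}

/-- The elements of colour `c` in a list of coloured elements. -/
noncomputable def ofColour (L : List (ε × Bool)) (c : Bool) : Finset ε :=
  ((L.filter fun p => p.2 = c).map Prod.fst).toFinset

theorem mem_ofColour {L : List (ε × Bool)} {c : Bool} {e : ε} :
    e ∈ ofColour L c ↔ (e, c) ∈ L := by
  simp [ofColour]

/-- The position of `e` in the list `l`. -/
noncomputable def position (l : List ε) (e : ε) : ℕ :=
  l.idxOf e

theorem position_eq {l : List ε} (hl : l.Nodup) {e : ε} {A B : List ε} (h : l = A ++ e :: B) :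
    position l e = A.length := by
  rw [h, List.nodup_append'] at hl
  rw [position, h, List.idxOf_append_of_notMem fun h => hl.2.2 h (by simp)]
  simp

theorem position_lt_length {l : List ε} {e : ε} (he : e ∈ l) : position l e < l.length :=
  List.idxOf_lt_length_of_mem he

theorem eq_of_position_eq {l : List ε} {e e' : ε} (he : e ∈ l) (h : position l e = position l e') :
    e = e' :=
  (List.idxOf_inj he).1 h

theorem before_ofColour {L A B : List (ε × Bool)} (hL : (L.map Prod.fst).Nodup) {e : ε}
    {c c' : Bool} (h : L = A ++ (e, c) :: B) :
    before (position (L.map Prod.fst)) (ofColour L c') e =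
      A.countP (fun p => p.2 = c') := by
  have hA : (A.map Prod.fst).Nodup := by
    rw [h, List.map_append, List.nodup_append'] at hL
    exact hL.1
  have hnd : ((A.filter fun p => p.2 = c').map Prod.fst).Nodup :=
    hA.sublist (List.filter_sublist.map _)
  rw [List.countP_eq_length_filter, ← List.length_map (f := Prod.fst),
    ← List.toFinset_card_of_nodup hnd, before,
    position_eq hL (A := A.map Prod.fst) (B := B.map Prod.fst) (by simp [h]), List.length_map]
  congr 1
  ext x
  rw [Finset.mem_filter, mem_ofColour]
  simp only [List.mem_toFinset, List.mem_map, List.mem_filter, decide_eq_true_eq, Prod.exists,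
    exists_and_right, exists_eq_right]
  constructor
  · rintro ⟨hx, hlt⟩
    have hxA : x ∈ A.map Prod.fst := by
      by_contra hxA
      rw [position, h, List.map_append, List.idxOf_append_of_notMem hxA, List.length_map] at hlt
      omega
    obtain ⟨⟨x, d⟩, hxd, rfl⟩ := List.mem_map.1 hxA
    obtain rfl := eq_of_mem_of_nodup_map_fst hL hx (h ▸ List.mem_append_left _ hxd)
    exact hxd
  · intro hx
    have hxA : x ∈ A.map Prod.fst := List.mem_map_of_mem (f := Prod.fst) hx
    refine ⟨h ▸ List.mem_append_left _ hx, ?_⟩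
    rw [position, h, List.map_append, List.idxOf_append_of_mem hxA,
      ← List.length_map (f := Prod.fst)]
    exact List.idxOf_lt_length_of_mem hxA

/-- The edges of a list of blocks with their colours. -/
def colouring (𝓑 : List (Bool × List ε)) : List (ε × Bool) :=
  𝓑.flatMap fun p => alternate p.1 p.2

theorem colouring_append (𝓐 𝓑 : List (Bool × List ε)) :
    colouring (𝓐 ++ 𝓑) = colouring 𝓐 ++ colouring 𝓑 :=
  List.flatMap_append

theorem colouring_cons (p : Bool × List ε) (𝓑 : List (Bool × List ε)) :
    colouring (p :: 𝓑) = alternate p.1 p.2 ++ colouring 𝓑 :=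
  List.flatMap_cons

theorem mem_colouring {𝓑 : List (Bool × List ε)} {x : ε × Bool} :
    x ∈ colouring 𝓑 ↔ ∃ p ∈ 𝓑, x ∈ alternate p.1 p.2 :=
  List.mem_flatMap

theorem map_fst_colouring (𝓑 : List (Bool × List ε)) :
    (colouring 𝓑).map Prod.fst = (𝓑.map Prod.snd).flatten := by
  induction 𝓑 with
  | nil => rfl
  | cons p 𝓑 ih =>
    rw [colouring_cons, List.map_append, map_fst_alternate, ih, List.map_cons, List.flatten_cons]

theorem countP_colouring_le {𝓑 : List (Bool × List ε)} (h : ∀ p ∈ 𝓑, p.1 = false) :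
    (colouring 𝓑).countP (fun p => p.2 = true) ≤ (colouring 𝓑).countP (fun p => p.2 = false) := by
  induction 𝓑 with
  | nil => simp [colouring]
  | cons p 𝓑 ih =>
    have h1 := countP_prefix_alternate (c := p.1) (T := p.2) (List.append_nil _).symm
    have h2 := ih fun q hq => h q (by simp [hq])
    rw [h p (by simp)] at h1
    rw [colouring_cons, List.countP_append, List.countP_append, h p (by simp)]
    simp at h1 h2 ⊢
    omega

/-- The blocks are reordered: first the block containing `ρ` if it begins with `true`, then the
blocks that begin with `false`, then the others. -/
theorem exists_perm_blocks (𝓑 : List (Bool × List ε)) (h𝓑 : (𝓑.map Prod.snd).flatten.Nodup)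
    (ρ : ε) :
    ∃ Z F S : List (Bool × List ε), (Z ++ (F ++ S)).Perm 𝓑 ∧ Z.length ≤ 1 ∧
      (∀ p ∈ F, p.1 = false) ∧ (∀ p ∈ S, p.1 = true ∧ ρ ∉ p.2) ∧ ∀ p ∈ Z, p.1 = true := by
  have hperm : (𝓑.filter (fun p => p.1) ++ 𝓑.filter fun p => !p.1).Perm 𝓑 :=
    List.filter_append_perm _ _
  by_cases hex : ∃ p ∈ 𝓑, p.1 = true ∧ ρ ∈ p.2
  · obtain ⟨p, hp, hp1, hρ⟩ := hex
    have hpQ : p ∈ 𝓑.filter (fun p => p.1) := by simp [hp, hp1]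
    have hperm' := List.perm_cons_erase hpQ
    refine ⟨[p], 𝓑.filter fun p => !p.1, (𝓑.filter (fun p => p.1)).erase p, ?_, by simp, by simp,
      ?_, by simpa using hp1⟩
    · refine List.Perm.trans ?_ hperm
      refine List.Perm.trans ?_ (hperm'.symm.append_right _)
      rw [List.cons_append, List.nil_append, List.cons_append]
      exact (List.perm_append_comm).cons _
    · intro q hq
      have hq' := List.mem_of_mem_erase hq
      refine ⟨by simpa using (List.mem_filter.1 hq').2, fun hρq => ?_⟩
      have hnd : ((p :: (𝓑.filter (fun p => p.1)).erase p).map Prod.snd).flatten.Nodup := by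
        rw [← ((hperm'.map Prod.snd).flatten).nodup_iff]
        exact h𝓑.sublist (List.Sublist.flatten (List.filter_sublist.map _))
      rw [List.map_cons, List.flatten_cons, List.nodup_append'] at hnd
      exact hnd.2.2 hρ (List.mem_flatten.2 ⟨_, List.mem_map_of_mem hq, hρq⟩)
  · push Not at hex
    refine ⟨[], 𝓑.filter fun p => !p.1, 𝓑.filter (fun p => p.1), ?_, by simp, by simp, ?_, by simp⟩
    · rw [List.nil_append]
      exact List.perm_append_comm.trans hperm
    · intro p hp
      rw [List.mem_filter] at hp
      exact ⟨hp.2, hex p hp.1 hp.2⟩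

end Order

section Cover

variable {V : Type*} [Fintype V] {G : SimpleGraph V}

/-- A thread containing all edges at its ends meets every vertex. -/
theorem IsThread.exists_mem {D : Set V} (hG : G.Connected) (hD : ∀ v ∈ D, G.degree v = 2)
    {a b : V} {T : List (Sym2 V)} (hT : IsThread G D a T b) (hnd : T.Nodup)
    (hTE : ∀ e ∈ T, e ∈ edgeFS G) (ha : ∀ e ∈ edgeFS G, a ∈ e → e ∈ T)
    (hb : ∀ e ∈ edgeFS G, b ∈ e → e ∈ T) (w : V) : ∃ e ∈ T, w ∈ e := by
  obtain ⟨e, T', hTe, hae⟩ := hT.exists_eq_cons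
  have hcov : ∀ v, (∃ e ∈ T, v ∈ e) → ∀ e ∈ edgeFS G, v ∈ e → e ∈ T := by
    rintro v ⟨e, heT, hve⟩ e' he' hve'
    rcases hT.mem_cases heT hve with ⟨rfl, -⟩ | ⟨rfl, -⟩ | ⟨hv, A, e₁, e₂, B, hTeq, h₁, h₂⟩
    · exact ha e' he' hve'
    · exact hb e' he' hve'
    · have hne : e₁ ≠ e₂ := by
        rintro rfl
        rw [hTeq, List.nodup_append'] at hnd
        simpa using hnd.2.1
      have he₁ : e₁ ∈ T := by simp [hTeq]
      have he₂ : e₂ ∈ T := by simp [hTeq]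
      have : e' ∈ (edgeFS G).filter fun e => v ∈ e := Finset.mem_filter.2 ⟨he', hve'⟩
      rw [filter_eq_pair (hD v hv) hne (hTE _ he₁) (hTE _ he₂) h₁ h₂] at this
      rcases (by simpa using this : e' = e₁ ∨ e' = e₂) with rfl | rfl <;> assumption
  exact hG.mem_of_adj_closed (S := {v | ∃ e ∈ T, v ∈ e}) (u := a)
    ⟨e, by simp [hTe], hae⟩ (fun v hv z hvz => ⟨s(v, z), hcov v hv _ (mk_mem_edgeFS.2 hvz)
      (by simp), by simp⟩) w

theorem filter_mem_injective (hG : G.Connected) (hcard : 2 ≤ (edgeFS G).card) :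
    Function.Injective fun v => (edgeFS G).filter fun e => v ∈ e := by
  intro v w hvw
  by_contra hne
  dsimp only at hvw
  have key : ∀ {v w : V}, v ≠ w → ((edgeFS G).filter fun e => v ∈ e) =
      ((edgeFS G).filter fun e => w ∈ e) → ∀ z, G.Adj v z → z = w := by
    intro v w hne hvw z hz
    have : s(v, z) ∈ (edgeFS G).filter fun e => v ∈ e := by simp [mk_mem_edgeFS.2 hz]
    rw [hvw, Finset.mem_filter] at this
    rcases Sym2.mem_iff.1 this.2 with h | h
    · exact absurd h.symm hne
    · exact h.symm
  have hmem := hG.mem_of_adj_closed (S := {v, w}) (u := v) (by simp) (by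
    rintro x (rfl | rfl) z hz
    · exact Or.inr (key hne hvw z hz)
    · exact Or.inl (key (Ne.symm hne) hvw.symm z hz))
  have hall : ∀ e ∈ edgeFS G, e = s(v, w) := by
    intro e he
    induction e using Sym2.ind with
    | _ x y =>
      have hxy := mk_mem_edgeFS.1 he
      rcases hmem x with rfl | rfl
      · rw [key hne hvw y hxy]
      · rw [key (Ne.symm hne) hvw.symm y hxy, Sym2.eq_swap]
  have := Finset.card_le_one.2 fun x hx y hy => (hall x hx).trans (hall y hy).symm
  omega

end Cover

section Heavy

variable {V : Type*} [Fintype V] {G : SimpleGraph V}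

theorem exists_blocks {R : Finset (Sym2 V)} {f : V → Sym2 V} {ρ : Sym2 V}
    (hG : G.Connected) {h : V} (hh : 3 ≤ G.degree h) (hf : IsChoice G R f ρ)
    {𝒯 : List (List (Sym2 V))} (hnd : 𝒯.flatten.Nodup) (hE : ∀ e ∈ 𝒯.flatten, e ∈ edgeFS G)
    (h𝒯 : ∀ T ∈ 𝒯, ∃ a b, IsThread G {v | G.degree v = 2} a T b ∧ G.degree a ≠ 2 ∧
      G.degree b ≠ 2) :
    ∃ 𝓑 : List (Bool × List (Sym2 V)), (𝓑.map Prod.snd).flatten.Perm 𝒯.flatten ∧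
      ∀ p ∈ 𝓑, IsBlock G f ρ p.1 p.2 := by
  induction 𝒯 with
  | nil => exact ⟨[], by simp⟩
  | cons T 𝒯 ih =>
    rw [List.flatten_cons, List.nodup_append'] at hnd
    obtain ⟨𝓑, h1, h2⟩ := ih hnd.2.1 (fun e he => hE e (by
      rw [List.flatten_cons]; exact List.mem_append_right _ he)) fun T hT => h𝒯 T (by simp [hT])
    obtain ⟨a, b, hT, ha, hb⟩ := h𝒯 T (by simp)
    have hTE : ∀ e ∈ T, e ∈ edgeFS G := fun e he => hE e (by
      rw [List.flatten_cons]; exact List.mem_append_left _ he)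
    obtain ⟨c, T', hperm, hblock⟩ := hT.exists_isBlock hf hnd.1 hTE ha hb (by
      intro ha1 hb1
      have hend : ∀ {w e₀}, G.degree w = 1 → e₀ ∈ T → w ∈ e₀ → ∀ e ∈ edgeFS G, w ∈ e → e ∈ T := by
        intro w e₀ hw h₀ hwe₀ e he hwe
        have : e ∈ (edgeFS G).filter fun e => w ∈ e := Finset.mem_filter.2 ⟨he, hwe⟩
        rw [filter_eq_singleton hw (hTE e₀ h₀) hwe₀, Finset.mem_singleton] at this
        exact this ▸ h₀
      obtain ⟨e, T₁, hT₁, hae⟩ := hT.exists_eq_cons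
      obtain ⟨e', T₂, hT₂, hbe'⟩ := hT.reverse.exists_eq_cons
      have he' : e' ∈ T := List.mem_reverse.1 (by simp [hT₂])
      obtain ⟨e'', he'', hhe''⟩ := hT.exists_mem hG (fun v hv => hv) hnd.1 hTE
        (hend ha1 (by simp [hT₁]) hae) (hend hb1 he' hbe') h
      rcases hT.mem_cases he'' hhe'' with ⟨rfl, -⟩ | ⟨rfl, -⟩ | ⟨h', -⟩
      · omega
      · omega
      · have : G.degree h = 2 := h'
        omega)
    refine ⟨(c, T') :: 𝓑, ?_, ?_⟩
    · simpa using hperm.append h1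
    · intro p hp
      rcases List.mem_cons.1 hp with rfl | hp
      · exact hblock
      · exact h2 p hp

theorem exists_index_of_three_le_degree (hG : G.Connected) {h : V} (hh : 3 ≤ G.degree h)
    (hsupp : ∀ v : V, 3 ≤ G.degree v → ∃ u : V, G.Adj v u ∧ G.degree u = 1) {α : ℝ} (hα : 0 < α) :
    ∃ idx : Sym2 V → ℕ, Set.BijOn idx (edgeFS G) (Finset.range (edgeFS G).card) ∧
      Function.Injective fun v => ∑ e ∈ (edgeFS G).filter (fun e => v ∈ e), (α + idx e) := by
  have hcard : 2 ≤ (edgeFS G).card := by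
    have := Finset.card_le_card (Finset.filter_subset (fun e => h ∈ e) (edgeFS G))
    rw [card_filter_mem_edgeFS] at this
    omega
  have hl : ∀ v, ∃ u, 3 ≤ G.degree v → G.Adj v u ∧ G.degree u = 1 := by
    intro v
    by_cases hv : 3 ≤ G.degree v
    · obtain ⟨u, hu⟩ := hsupp v hv
      exact ⟨u, fun _ => hu⟩
    · exact ⟨v, fun h => absurd h hv⟩
  choose l hl using hl
  set H : Finset V := Finset.univ.filter fun v => 3 ≤ G.degree v with hHdef
  have hH : ∀ {v}, v ∈ H ↔ 3 ≤ G.degree v := by simp [hHdef]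
  set res : V → Sym2 V := fun v => s(v, l v) with hresdef
  have hres : IsReservation G H res := fun v hv =>
    ⟨hH.1 hv, l v, rfl, (hl v (hH.1 hv)).1, (hl v (hH.1 hv)).2⟩
  have hRdeg : ∀ {e v}, e ∈ H.image res → v ∈ e → G.degree v ≠ 2 := by
    intro e v he hve h2
    obtain ⟨w, hw, rfl⟩ := Finset.mem_image.1 he
    have := hH.1 hw
    rw [← hres.eq_of_mem hw h2.ge hve] at this
    omega
  obtain ⟨f, ρ, hf⟩ := exists_edge_choice hG hres
  obtain ⟨𝒯, hnd, hmem, h𝒯⟩ := exists_thread_decomposition hG (D := {v | G.degree v = 2})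
    (fun v hv => hv) (r := h) (by simp; omega) (H.image res)
    (fun w hw e he e' he' hwe hwe' heR => absurd hw (hRdeg heR hwe))
  obtain ⟨𝓑₀, hperm₀, hblock₀⟩ := exists_blocks hG hh hf hnd (fun e he => ((hmem e).1 he).1) h𝒯
  obtain ⟨Z, F, S, hperm, hZ, hF, hS, hZ1⟩ :=
    exists_perm_blocks 𝓑₀ (hperm₀.nodup_iff.2 hnd) ρ
  set 𝓑 := Z ++ (F ++ S) with h𝓑
  set L := colouring 𝓑 with hL
  have hblock : ∀ p ∈ 𝓑, IsBlock G f ρ p.1 p.2 := fun p hp => hblock₀ p (hperm.mem_iff.1 hp)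
  have hfst : (L.map Prod.fst).Perm 𝒯.flatten := by
    rw [hL, map_fst_colouring]
    exact ((hperm.map Prod.snd).flatten).trans hperm₀
  have hLnd : (L.map Prod.fst).Nodup := hfst.nodup_iff.2 hnd
  have hLmem : ∀ e, (∃ c, (e, c) ∈ L) ↔ e ∈ edgeFS G ∧ e ∉ H.image res := by
    intro e
    rw [← hmem, ← hfst.mem_iff]
    simp
  have hLblock : ∀ {e}, e ∈ edgeFS G → e ∉ H.image res → ∃ p ∈ 𝓑, e ∈ p.2 := by
    intro e he heR
    obtain ⟨c, hc⟩ := (hLmem e).2 ⟨he, heR⟩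
    obtain ⟨p, hp, hep⟩ := mem_colouring.1 hc
    exact ⟨p, hp, mem_of_mem_alternate hep⟩
  have hsub : ∀ {p x}, p ∈ 𝓑 → x ∈ alternate p.1 p.2 → x ∈ L := fun hp hx =>
    mem_colouring.2 ⟨_, hp, hx⟩
  convert exists_injective_sum (ofColour L false) (ofColour L true) (edgeFS G) H res
    (fun v e => v ∈ e) (position (L.map Prod.fst)) α hα ?_ ?_ ?_ ?_ ?_ ?_ ?_ ?_ ?_
    (by convert filter_mem_injective hG hcard)
  · intro e
    rw [mem_ofColour, mem_ofColour, ← Finset.mem_image, ← or_assoc]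
    have : ((e, false) ∈ L ∨ (e, true) ∈ L) ↔ ∃ c, (e, c) ∈ L := by simp
    rw [this, hLmem]
    constructor
    · tauto
    · rintro (h | h)
      · exact h.1
      · obtain ⟨v, hv, rfl⟩ := Finset.mem_image.1 h
        exact hres.mem_edgeFS hv
  · rw [Finset.disjoint_left]
    intro e h1 h2
    rw [mem_ofColour] at h1 h2
    exact absurd (eq_of_mem_of_nodup_map_fst hLnd h1 h2) (by simp)
  · intro e he e' he' heq
    rw [Set.mem_ofPred_eq, mem_ofColour, mem_ofColour] at he
    rcases he with he | he <;> 
      exact eq_of_position_eq (List.mem_map_of_mem (f := Prod.fst) he) heq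
  · intro v hv h
    exact ((hLmem _).1 ⟨_, mem_ofColour.1 h⟩).2 (Finset.mem_image_of_mem _ hv)
  · intro v hv h
    exact ((hLmem _).1 ⟨_, mem_ofColour.1 h⟩).2 (Finset.mem_image_of_mem _ hv)
  · intro v hv w hw
    refine ⟨fun h => hres.eq_of_mem hv ?_ h, ?_⟩
    · have := hH.1 hw
      omega
    · rintro rfl
      exact hres.mem hv
  · intro v hv
    have hv3 := hH.1 hv
    have hs := hf.spec v (by omega)
    obtain ⟨p, hp, hep⟩ := hLblock hs.1 hs.2.1
    exact ⟨f v, mem_ofColour.2 (hsub hp ((hblock p hp).choice v hv3 hep)), hs.2.2⟩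
  · intro v hv e he hve
    obtain ⟨p, hp, hep⟩ := mem_colouring.1 (mem_ofColour.1 he)
    have hp1 : p.1 ≠ true := fun h => (hblock p hp).inner h e v (hH.1 hv) hve hep
    have hpF : p ∈ F := by
      rw [h𝓑, List.mem_append, List.mem_append] at hp
      rcases hp with hp | hp | hp
      · exact absurd (hZ1 p hp) hp1
      · exact hp
      · exact absurd (hS p hp).1 hp1
    obtain ⟨F₁, F₂, hF12⟩ := List.append_of_mem hpF
    obtain ⟨A, B, hAB⟩ := List.append_of_mem hep
    have hsplit : L = (colouring Z ++ (colouring F₁ ++ A)) ++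
        (e, false) :: (B ++ (colouring F₂ ++ colouring S)) := by
      rw [hL, h𝓑, colouring_append, colouring_append, hF12, colouring_append, colouring_cons, hAB]
      simp only [List.append_assoc, List.cons_append]
    rw [before_ofColour hLnd hsplit, before_ofColour hLnd hsplit]
    have h1 : (colouring Z).countP (fun p => p.2 = true) ≤
        (colouring Z).countP (fun p => p.2 = false) + 1 := by
      match Z, hZ, hZ1 with
      | [], _, _ => simp [colouring]
      | [q], _, hq =>
        have := countP_prefix_alternate (c := q.1) (T := q.2) (List.append_nil _).symm
        rw [hq q (by simp)] at this
        simpa [colouring, hq q (by simp)] using this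
    have h2 := countP_colouring_le (𝓑 := F₁) fun q hq => hF q (by simp [hF12, hq])
    have h3 := countP_prefix_alternate hAB
    rw [hF p hpF] at h3
    simp only [List.countP_append]
    simp at h1 h2 h3 ⊢
    omega
  · intro w hw
    have hw3 : ¬ 3 ≤ G.degree w := fun h => hw (hH.2 h)
    have hw0 : 0 < G.degree w := by
      have : Nontrivial V := by
        obtain ⟨u, hu, -⟩ := hsupp h hh
        exact ⟨h, u, hu.ne⟩
      exact hG.preconnected.degree_pos_of_nontrivial w
    rcases (by omega : G.degree w = 1 ∨ G.degree w = 2) with hw1 | hw2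
    · right
      obtain ⟨u, hu⟩ := (G.degree_pos_iff_exists_adj w).1 hw0
      have he := mk_mem_edgeFS.2 hu
      refine ⟨s(w, u), he, ?_, by convert filter_eq_singleton hw1 he (by simp)⟩
      intro heY
      rw [mem_ofColour] at heY
      obtain ⟨p, hp, hep⟩ := mem_colouring.1 heY
      rcases (hblock p hp).leaf w _ hw1 (by simp) (mem_of_mem_alternate hep) with
        hlf | ⟨hc, hhead, hρ⟩
      · exact absurd (eq_of_mem_of_nodup_map_fst hLnd heY (hsub hp hlf)) (by simp)
      · have hpZ : p ∈ Z := by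
          rw [h𝓑, List.mem_append, List.mem_append] at hp
          rcases hp with hp | hp | hp
          · exact hp
          · rw [hF p hp] at hc
            exact absurd hc (by simp)
          · exact absurd (hρ ▸ mem_of_mem_alternate hep) (hS p hp).2
        obtain ⟨Z', hZ'⟩ : ∃ Z', Z = p :: Z' := by
          match Z, hZ, hpZ with
          | [q], _, hq => exact ⟨[], by rw [List.mem_singleton.1 hq]⟩
        obtain ⟨T', hT'⟩ : ∃ T', p.2 = s(w, u) :: T' := List.head?_eq_some_iff.1 hhead
        have hsplit : L = [] ++ (s(w, u), p.1) :: (alternate (!p.1) T' ++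
            (colouring Z' ++ colouring (F ++ S))) := by
          rw [hL, h𝓑, colouring_append, hZ', colouring_cons, hT', alternate]
          simp
        rw [before_ofColour hLnd hsplit]
        rfl
    · left
      obtain ⟨e₁, e₂, -, hfil⟩ := exists_filter_eq_pair hw2
      have he₁ : e₁ ∈ (edgeFS G).filter fun e => w ∈ e := by simp [hfil]
      rw [Finset.mem_filter] at he₁
      obtain ⟨p, hp, hep⟩ := hLblock he₁.1 fun h => hRdeg h he₁.2 hw2
      obtain ⟨a, b, hT, ha, hb⟩ := (hblock p hp).thread
      rcases hT.mem_cases hep he₁.2 with ⟨rfl, -⟩ | ⟨rfl, -⟩ | ⟨-, A, x, y, B, hAB, hx, hy⟩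
      · exact absurd hw2 ha
      · exact absurd hw2 hb
      obtain ⟨P, Q, hPQ⟩ := List.append_of_mem hp
      obtain ⟨c, hxc, hyc⟩ := mem_alternate_of_consecutive (A := A) (B := B) (e₁ := x) (e₂ := y) p.1
      rw [← hAB] at hxc hyc
      have hxL := hsub hp hxc
      have hyL := hsub hp hyc
      have hne : x ≠ y := by
        rintro rfl
        have := eq_of_mem_of_nodup_map_fst hLnd hxL hyL
        simp at this
      have hsplit : L.map Prod.fst = ((P.map Prod.snd).flatten ++ A) ++
          x :: y :: (B ++ (Q.map Prod.snd).flatten) := by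
        rw [hL, map_fst_colouring, hPQ]
        simp [hAB]
      have hposx := position_eq hLnd hsplit
      have hposy := position_eq hLnd (e := y) (A := (P.map Prod.snd).flatten ++ A ++ [x])
        (B := B ++ (Q.map Prod.snd).flatten) (by simp [hsplit])
      rw [List.length_append, List.length_singleton] at hposy
      have hxE := ((hLmem x).1 ⟨_, hxL⟩).1
      have hyE := ((hLmem y).1 ⟨_, hyL⟩).1
      cases c
      · exact ⟨x, mem_ofColour.2 hxL, y, mem_ofColour.2 hyL, by omega,
          by convert filter_eq_pair hw2 hne hxE hyE hx hy⟩
      · exact ⟨y, mem_ofColour.2 hyL, x, mem_ofColour.2 hxL, by omega,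
          by convert filter_eq_pair hw2 hne.symm hyE hxE hy hx⟩

end Heavy

theorem IsThread.exists_ne_of_closed {V : Type*} {G : SimpleGraph V} {D : Set V} {a : V}
    {T : List (Sym2 V)} (hT : IsThread G D a T a) (hnd : T.Nodup) :
    ∃ x y A, T = x :: (A ++ [y]) ∧ x ≠ y ∧ a ∈ x ∧ a ∈ y := by
  cases hT with
  | single h => exact absurd h G.irrefl
  | @cons _ u _ T h hu hT =>
    obtain ⟨y, T', hT', hy⟩ := hT.reverse.exists_eq_cons
    obtain rfl : T = T'.reverse ++ [y] := by rw [← List.reverse_reverse T, hT', List.reverse_cons]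
    refine ⟨_, y, T'.reverse, rfl, ?_, by simp, hy⟩
    rintro rfl
    simp at hnd

section PathOrCycle

variable {V : Type*} [Fintype V] {G : SimpleGraph V}

/-- In a path or cycle, the edges can be listed so that the two edges at each inner vertex are
consecutive, up to one vertex of a cycle that has the first and the last edge. -/
theorem exists_edge_list (hG : G.Connected) (hdeg : ∀ v, G.degree v ≤ 2)
    (hcard : 0 < (edgeFS G).card) :
    ∃ T : List (Sym2 V), T.Nodup ∧ (∀ e, e ∈ T ↔ e ∈ edgeFS G) ∧ ∀ w,
      (∃ e, (edgeFS G).filter (fun e => w ∈ e) = {e} ∧ (T.head? = some e ∨ T.getLast? = some e)) ∨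
      ∃ x y, x ≠ y ∧ (edgeFS G).filter (fun e => w ∈ e) = {x, y} ∧
        ((∃ A B, T = A ++ x :: y :: B) ∨ ∃ A, T = x :: (A ++ [y])) := by
  have : Nontrivial V := by
    obtain ⟨e, he⟩ := Finset.card_pos.1 hcard
    induction e using Sym2.ind with
    | _ x y => exact ⟨x, y, (mk_mem_edgeFS.1 he).ne⟩
  have hpos : ∀ v, 0 < G.degree v := fun v => hG.preconnected.degree_pos_of_nontrivial v
  obtain ⟨r, hr⟩ : ∃ r, G.degree r = 1 ∨ ∀ v, G.degree v = 2 := by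
    by_cases h : ∃ r, G.degree r = 1
    · exact h.imp fun r => Or.inl
    · push Not at h
      obtain ⟨r⟩ := hG.nonempty
      refine ⟨r, Or.inr fun v => ?_⟩
      have := hpos v
      have := hdeg v
      have := h v
      omega
  set D : Set V := {v | G.degree v = 2 ∧ v ≠ r} with hDdef
  have hD : ∀ v ∈ D, G.degree v = 2 := fun v hv => hv.1
  obtain ⟨c, hc⟩ := (G.degree_pos_iff_exists_adj r).1 (hpos r)
  obtain ⟨T, b, hT, hb, hnd, hTE, hcl⟩ := exists_thread_of_edge hD (U := ∅) (a := r) (c := c)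
    (fun w _ e _ e' _ _ _ h => absurd h (by simp)) hc (by simp) (fun h => h.2 rfl)
  replace hTE : ∀ e ∈ T, e ∈ edgeFS G := fun e he => (hTE e he).1
  have hend : ∀ {w e₀}, G.degree w = 1 → e₀ ∈ T → w ∈ e₀ → ∀ e ∈ edgeFS G, w ∈ e → e ∈ T := by
    intro w e₀ hw h₀ hwe₀ e he hwe
    have : e ∈ (edgeFS G).filter fun e => w ∈ e := Finset.mem_filter.2 ⟨he, hwe⟩
    rw [filter_eq_singleton hw (hTE e₀ h₀) hwe₀, Finset.mem_singleton] at this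
    exact this ▸ h₀
  obtain ⟨e, T₁, hT₁, hre⟩ := hT.exists_eq_cons
  obtain ⟨e', T₂, hT₂, hbe'⟩ := hT.reverse.exists_eq_cons
  have he' : e' ∈ T := List.mem_reverse.1 (by simp [hT₂])
  have hcycle : (∀ v, G.degree v = 2) → ∃ x y A, T = x :: (A ++ [y]) ∧ x ≠ y ∧ b = r ∧
      (edgeFS G).filter (fun e => r ∈ e) = {x, y} := by
    intro h2
    obtain rfl : b = r := by
      by_contra hne
      exact hb ⟨h2 b, hne⟩
    obtain ⟨x, y, A, hxy, hne, hx, hy⟩ := hT.exists_ne_of_closed hnd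
    exact ⟨x, y, A, hxy, hne, rfl, filter_eq_pair (h2 b) hne (hTE x (by simp [hxy]))
      (hTE y (by simp [hxy])) hx hy⟩
  have hr' : ∀ e ∈ edgeFS G, r ∈ e → e ∈ T := by
    rcases hr with h1 | h2
    · exact hend h1 (by simp [hT₁]) hre
    · obtain ⟨x, y, A, hxy, -, -, hfil⟩ := hcycle h2
      intro e he hre
      have : e ∈ (edgeFS G).filter fun e => r ∈ e := Finset.mem_filter.2 ⟨he, hre⟩
      rw [hfil] at this
      rcases (by simpa using this : e = x ∨ e = y) with rfl | rfl <;> simp [hxy]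
  have hb' : ∀ e ∈ edgeFS G, b ∈ e → e ∈ T := by
    by_cases hbr : b = r
    · exact hbr ▸ hr'
    · refine hend ?_ he' hbe'
      have h1 := hpos b
      have h2 := hdeg b
      have h3 : G.degree b ≠ 2 := fun h => hb ⟨h, hbr⟩
      omega
  have hmeet := hT.exists_mem hG hD hnd hTE hr' hb'
  have hpair : ∀ {w x y A B}, G.degree w = 2 → T = A ++ x :: y :: B → w ∈ x → w ∈ y →
      x ≠ y ∧ (edgeFS G).filter (fun e => w ∈ e) = {x, y} := by
    intro w x y A B hw hAB hx hy
    have hne : x ≠ y := by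
      rintro rfl
      rw [hAB, List.nodup_append'] at hnd
      simpa using hnd.2.1
    exact ⟨hne, filter_eq_pair hw hne (hTE x (by simp [hAB])) (hTE y (by simp [hAB])) hx hy⟩
  refine ⟨T, hnd, fun e => ⟨hTE e, fun he => ?_⟩, fun w => ?_⟩
  · induction e using Sym2.ind with
    | _ w z =>
      obtain ⟨e₁, he₁, hwe₁⟩ := hmeet w
      rcases hT.mem_cases he₁ hwe₁ with ⟨rfl, -⟩ | ⟨rfl, -⟩ | ⟨h, -⟩
      · exact hr' _ he (by simp)
      · exact hb' _ he (by simp)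
      · have := hcl w h e₁ (hTE e₁ he₁) s(w, z) he hwe₁ (by simp) (by simp [he₁])
        simpa using this
  · obtain ⟨e₁, he₁, hwe₁⟩ := hmeet w
    rcases (by have := hpos w; have := hdeg w; omega : G.degree w = 1 ∨ G.degree w = 2) with h1 | h2
    · refine Or.inl ⟨e₁, filter_eq_singleton h1 (hTE e₁ he₁) hwe₁, ?_⟩
      rcases hT.mem_cases he₁ hwe₁ with ⟨-, h⟩ | ⟨-, h⟩ | ⟨h, -⟩
      · exact Or.inl h
      · exact Or.inr h
      · have := hD w h
        omega
    · right
      by_cases hwr : w = r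
      · subst hwr
        obtain ⟨x, y, A, hxy, hne, -, hfil⟩ := hcycle (hr.resolve_left (by omega))
        exact ⟨x, y, hne, hfil, Or.inr ⟨A, hxy⟩⟩
      · rcases hT.mem_cases he₁ hwe₁ with ⟨h, -⟩ | ⟨rfl, -⟩ | ⟨-, A, x, y, B, hAB, hx, hy⟩
        · exact absurd h hwr
        · exact absurd ⟨h2, hwr⟩ hb
        · obtain ⟨hne, hfil⟩ := hpair h2 hAB hx hy
          exact ⟨x, y, hne, hfil, Or.inl ⟨A, B, hAB⟩⟩

/-- Even numbers in increasing order followed by the odd numbers in decreasing order. -/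
def zigzag (m i : ℕ) : ℕ :=
  if 2 * i < m then 2 * i else 2 * (m - 1 - i) + 1

theorem zigzag_lt {m i : ℕ} (h : i < m) : zigzag m i < m := by
  unfold zigzag
  split_ifs <;> omega

theorem zigzag_inj {m i j : ℕ} (hi : i < m) (hj : j < m) (h : zigzag m i = zigzag m j) : i = j := by
  unfold zigzag at h
  split_ifs at h <;> omega

theorem zigzag_add_inj {m i j i' j' : ℕ} (hm : 3 ≤ m) (hj : j < m) (hj' : j' < m)
    (hij : j = i + 1 ∨ i = 0 ∧ j + 1 = m) (hij' : j' = i' + 1 ∨ i' = 0 ∧ j' + 1 = m)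
    (h : zigzag m i + zigzag m j = zigzag m i' + zigzag m j') : i = i' ∧ j = j' := by
  unfold zigzag at h
  split_ifs at h <;> omega

theorem exists_index_of_degree_le_two (hG : G.Connected) (hdeg : ∀ v, G.degree v ≤ 2)
    (hcard : 3 ≤ (edgeFS G).card) {α : ℝ} (hα : 0 < α) :
    ∃ idx : Sym2 V → ℕ, Set.BijOn idx (edgeFS G) (Finset.range (edgeFS G).card) ∧
      Function.Injective fun v => ∑ e ∈ (edgeFS G).filter (fun e => v ∈ e), (α + idx e) := by
  obtain ⟨T, hnd, hTE, hT⟩ := exists_edge_list hG hdeg (by omega)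
  have hinj := filter_mem_injective hG (by omega)
  set m := (edgeFS G).card with hm
  have hlen : T.length = m := by
    rw [hm, ← List.toFinset_card_of_nodup hnd]
    congr 1
    ext e
    simp [hTE]
  have hlt : ∀ {e}, e ∈ T → position T e < m := fun he => hlen ▸ position_lt_length he
  have hmaps : Set.MapsTo (fun e => zigzag m (position T e)) (edgeFS G) (Finset.range m) := by
    intro e he
    simpa using zigzag_lt (hlt ((hTE e).2 he))
  have hinjOn : Set.InjOn (fun e => zigzag m (position T e)) (edgeFS G) := fun e he e' he' h =>
    eq_of_position_eq ((hTE e).2 he)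
      (zigzag_inj (hlt ((hTE e).2 he)) (hlt ((hTE e').2 he')) h)
  refine ⟨_, ⟨hmaps, hinjOn, Finset.surjOn_of_injOn_of_card_le _ hmaps hinjOn (by simp [hm])⟩, ?_⟩
  have hclass : ∀ w,
      (∃ e, (edgeFS G).filter (fun e => w ∈ e) = {e} ∧ e ∈ T ∧ zigzag m (position T e) ≤ 1) ∨
      ∃ x y, x ≠ y ∧ (edgeFS G).filter (fun e => w ∈ e) = {x, y} ∧ x ∈ T ∧ y ∈ T ∧
        (position T y = position T x + 1 ∨ position T x = 0 ∧ position T y + 1 = m) := by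
    intro w
    rcases hT w with ⟨e, h1, h2 | h2⟩ | ⟨x, y, hne, hfil, ⟨A, B, h⟩ | ⟨A, h⟩⟩
    · obtain ⟨T', hT'⟩ := List.head?_eq_some_iff.1 h2
      refine Or.inl ⟨e, h1, by simp [hT'], ?_⟩
      rw [position_eq hnd (A := []) hT', List.length_nil]
      unfold zigzag
      split_ifs <;> omega
    · obtain ⟨T', hT'⟩ := List.getLast?_eq_some_iff.1 h2
      refine Or.inl ⟨e, h1, by simp [hT'], ?_⟩
      rw [position_eq hnd (B := []) hT']
      rw [hT', List.length_append, List.length_singleton] at hlen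
      unfold zigzag
      split_ifs <;> omega
    · refine Or.inr ⟨x, y, hne, hfil, by simp [h], by simp [h], Or.inl ?_⟩
      rw [position_eq hnd h, position_eq hnd (e := y) (A := A ++ [x]) (B := B) (by simp [h])]
      simp
    · refine Or.inr ⟨x, y, hne, hfil, by simp [h], by simp [h], Or.inr ⟨?_, ?_⟩⟩
      · rw [position_eq hnd (A := []) h]
        rfl
      · rw [position_eq hnd (e := y) (A := x :: A) (B := []) (by simp [h])]
        simpa [h] using hlen
  have hlow : ∀ {x y}, (position T y = position T x + 1 ∨ position T x = 0 ∧ position T y + 1 = m) →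
      y ∈ T → 1 ≤ zigzag m (position T x) + zigzag m (position T y) := by
    intro x y h hy
    have := hlt hy
    unfold zigzag
    split_ifs <;> omega
  have hmix : ∀ {e x y : Sym2 V}, zigzag m (position T e) ≤ 1 →
      1 ≤ zigzag m (position T x) + zigzag m (position T y) →
      α + zigzag m (position T e) < (α + zigzag m (position T x)) +
        (α + zigzag m (position T y)) := by
    intro e x y h1 h2
    rw [← Nat.cast_le (α := ℝ)] at h1 h2
    push_cast at h1 h2
    linarith
  intro v w hvw
  dsimp only at hvw
  refine hinj ?_
  dsimp only
  rcases hclass v with ⟨e, h1, he, h2⟩ | ⟨x, y, hne, hfil, hx, hy, hxy⟩ <;>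
    rcases hclass w with ⟨e', h1', he', h2'⟩ | ⟨x', y', hne', hfil', hx', hy', hxy'⟩
  · rw [h1, h1', Finset.sum_singleton, Finset.sum_singleton, add_right_inj, Nat.cast_inj] at hvw
    rw [h1, h1', hinjOn ((hTE e).1 he) ((hTE e').1 he') hvw]
  · rw [h1, hfil', Finset.sum_singleton, Finset.sum_pair hne'] at hvw
    exact absurd hvw (hmix h2 (hlow hxy' hy')).ne
  · rw [h1', hfil, Finset.sum_singleton, Finset.sum_pair hne] at hvw
    exact absurd hvw.symm (hmix h2' (hlow hxy hy)).ne
  · rw [hfil, hfil', Finset.sum_pair hne, Finset.sum_pair hne'] at hvw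
    have : zigzag m (position T x) + zigzag m (position T y) =
        zigzag m (position T x') + zigzag m (position T y') := by
      have : (zigzag m (position T x) + zigzag m (position T y) : ℝ) =
          zigzag m (position T x') + zigzag m (position T y') := by linarith
      exact_mod_cast this
    obtain ⟨h1, h2⟩ := zigzag_add_inj hcard (hlt hy) (hlt hy') hxy hxy' this
    rw [hfil, hfil', eq_of_position_eq hx h1, eq_of_position_eq hy h2]

end PathOrCycle

theorem arithAntimagic_of_exists_index {V : Type*} [Fintype V] {G : SimpleGraph V}
    (h : ∀ α : ℝ, 0 < α → ∃ idx : Sym2 V → ℕ,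
      Set.BijOn idx (edgeFS G) (Finset.range (edgeFS G).card) ∧
      Function.Injective fun v => ∑ e ∈ (edgeFS G).filter (fun e => v ∈ e), (α + idx e)) :
    ArithAntimagic G := by
  intro a d ha hd
  obtain ⟨idx, hbij, hinj⟩ := h (a / d) (div_pos ha hd)
  refine ⟨fun e => a + idx e * d, ?_, ?_⟩
  · rw [Finset.coe_image]
    refine Set.BijOn.comp (g := fun i : ℕ => a + (i : ℝ) * d) (Set.InjOn.bijOn_image ?_) hbij
    intro i _ j _ hij
    have : (i : ℝ) = j := by simpa [hd.ne'] using hij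
    exact_mod_cast this
  · intro v w hvw
    refine hinj ?_
    have key : ∀ v, vSum G (fun e => a + idx e * d) v =
        d * ∑ e ∈ (edgeFS G).filter (fun e => v ∈ e), (a / d + idx e) := by
      intro v
      rw [vSum, Finset.mul_sum]
      refine Finset.sum_congr rfl fun e _ => ?_
      field_simp
    rw [key, key] at hvw
    exact mul_left_cancel₀ hd.ne' hvw

/-- Every connected graph with `m ≥ 3` edges in which every vertex of
degree at least three is a support vertex is arithmetic antimagic. -/
theorem stmt_0 {V : Type*} [Fintype V] (G : SimpleGraph V) (m : ℕ) (hm : 3 ≤ m)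
    (hcard : (edgeFS G).card = m) (hconn : G.Connected)
    (hsupp : ∀ v : V, 3 ≤ G.degree v → ∃ u : V, G.Adj v u ∧ G.degree u = 1) :
    ArithAntimagic G := by
  apply arithAntimagic_of_exists_index
  intro α hα
  by_cases h : ∃ v, 3 ≤ G.degree v
  · obtain ⟨v, hv⟩ := h
    exact exists_index_of_three_le_degree hconn hv hsupp hα
  · push Not at h
    exact exists_index_of_degree_le_two hconn (fun v => by have := h v; omega) (hcard ▸ hm) hα
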